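/- arXiv:math/0501493 — 3 statements merged into one kernel-verified Lean document; each statement's English description precedes it below -/
import Mathlib

section
/- The kissing number in dimension 26 is at most 396447: every finite set of unit vectors x_1, …, x_N in ℝ^{26} satisfying ⟨x_i, x_j⟩ ≤ 1/2 for all i ≠ j has N ≤ 396447. -/
open scoped RealInnerProductSpace BigOperators

namespace MvPolynomial

variable {σ : Type*} [Fintype σ]

/-- The Fischer inner product `p(∂) q` evaluated at the origin. -/
noncomputable def fischer : MvPolynomial σ ℝ →ₗ[ℝ] MvPolynomial σ ℝ →ₗ[ℝ] ℝ :=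
  (basisMonomials σ ℝ).constr ℝ fun α => (∏ i, ((α i).factorial : ℝ)) • lcoeff ℝ α

theorem fischer_monomial (α : σ →₀ ℕ) (c : ℝ) (q : MvPolynomial σ ℝ) :
    fischer (monomial α c) q = c * ((∏ i, ((α i).factorial : ℝ)) * coeff α q) := by
  have h : fischer (monomial α (1 : ℝ)) = (∏ i, ((α i).factorial : ℝ)) • lcoeff ℝ α :=
    (basisMonomials σ ℝ).constr_basis ℝ _ α
  have hc : monomial α c = c • monomial α (1 : ℝ) := by simp [smul_monomial]
  rw [hc, map_smul, h]
  simp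

theorem fischer_self_nonneg (p : MvPolynomial σ ℝ) : 0 ≤ fischer p p := by
  have h : fischer p p =
      ∑ α ∈ p.support, coeff α p * ((∏ i, ((α i).factorial : ℝ)) * coeff α p) := by
    have : fischer p = ∑ α ∈ p.support, fischer (monomial α (coeff α p)) := by
      rw [← map_sum, ← p.as_sum]
    rw [this, LinearMap.sum_apply]
    exact Finset.sum_congr rfl fun α _ => fischer_monomial ..
  rw [h]
  refine Finset.sum_nonneg fun α _ => ?_
  rw [mul_left_comm]
  exact mul_nonneg (Finset.prod_nonneg fun i _ => Nat.cast_nonneg _) (mul_self_nonneg _)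

theorem fischer_X_mul (i : σ) (p q : MvPolynomial σ ℝ) :
    fischer (X i * p) q = fischer p (pderiv i q) := by
  classical
  induction p using MvPolynomial.induction_on' with
  | monomial α c =>
    have hX : X i * monomial α c = monomial (α + Finsupp.single i 1) c := by
      rw [monomial_add_single, pow_one, mul_comm]
    have hfac : ∏ j, ((((α + Finsupp.single i 1 : σ →₀ ℕ)) j).factorial : ℝ) =
        (α i + 1) * ∏ j, ((α j).factorial : ℝ) := by
      rw [← Finset.mul_prod_erase _ _ (Finset.mem_univ i),
        ← Finset.mul_prod_erase _ (fun j => ((α j).factorial : ℝ)) (Finset.mem_univ i), ← mul_assoc]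
      congr 1
      · simp [Nat.factorial_succ]
      · refine Finset.prod_congr rfl fun j hj => ?_
        simp [(Finset.ne_of_mem_erase hj).symm]
    rw [hX, fischer_monomial, fischer_monomial, coeff_pderiv, hfac]
    ring
  | add p₁ p₂ h₁ h₂ => simp [mul_add, h₁, h₂]

/-- The linear form with coefficients `a`. -/
noncomputable def linForm (a : σ → ℝ) : MvPolynomial σ ℝ := ∑ i, C (a i) * X i

/-- The squared Euclidean norm as a polynomial. -/
noncomputable def normSqPoly (σ : Type*) [Fintype σ] : MvPolynomial σ ℝ := ∑ i, X i ^ 2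

/-- The Laplace operator on polynomials. -/
noncomputable def laplace : MvPolynomial σ ℝ →ₗ[ℝ] MvPolynomial σ ℝ :=
  ∑ i, (pderiv i).toLinearMap ∘ₗ (pderiv i).toLinearMap

theorem laplace_apply (p : MvPolynomial σ ℝ) : laplace p = ∑ i, pderiv i (pderiv i p) := by
  simp [laplace, LinearMap.sum_apply]

theorem fischer_normSqPoly_mul (p q : MvPolynomial σ ℝ) :
    fischer (normSqPoly σ * p) q = fischer p (laplace q) := by
  simp [normSqPoly, laplace_apply, Finset.sum_mul, pow_two, mul_assoc, fischer_X_mul]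

theorem fischer_linForm_mul (a : σ → ℝ) (p q : MvPolynomial σ ℝ) :
    fischer (linForm a * p) q = ∑ i, a i * fischer p (pderiv i q) := by
  simp [linForm, Finset.sum_mul, ← smul_eq_C_mul, fischer_X_mul]

theorem fischer_linForm_pow (a : σ → ℝ) (k : ℕ) {q : MvPolynomial σ ℝ} (hq : q.IsHomogeneous k) :
    fischer (linForm a ^ k) q = k.factorial * eval a q := by
  induction k generalizing q with
  | zero =>
    obtain ⟨c, rfl⟩ : ∃ c, q = C c := by
      rw [← totalDegree_zero_iff_isHomogeneous, totalDegree_eq_zero_iff_eq_C] at hq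
      exact ⟨_, hq⟩
    have := fischer_monomial (0 : σ →₀ ℕ) 1 (C c)
    simpa using this
  | succ k ih =>
    have euler := congrArg (eval a) hq.sum_X_mul_pderiv
    simp only [map_sum, map_mul, eval_X, nsmul_eq_mul, map_natCast] at euler
    have hd : ∀ i, (pderiv i q).IsHomogeneous k := fun i => by simpa using hq.pderiv (i := i)
    simp_rw [pow_succ', fischer_linForm_mul, ih (hd _)]
    rw [Nat.factorial_succ, Nat.cast_mul, mul_right_comm, ← euler, Finset.sum_mul]
    exact Finset.sum_congr rfl fun i _ => by ring

theorem pderiv_linForm (a : σ → ℝ) (i : σ) : pderiv i (linForm a) = C (a i) := by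
  classical
  simp [linForm, pderiv_X, Pi.single_apply]

theorem pderiv_normSqPoly (i : σ) : pderiv i (normSqPoly σ) = 2 * X i := by
  classical
  simp [normSqPoly, pderiv_X, Pi.single_apply]

theorem laplace_mul (p q : MvPolynomial σ ℝ) :
    laplace (p * q) = laplace p * q + 2 * ∑ i, pderiv i p * pderiv i q + p * laplace q := by
  simp only [laplace_apply, Finset.sum_mul, Finset.mul_sum, ← Finset.sum_add_distrib]
  refine Finset.sum_congr rfl fun i _ => ?_
  simp only [pderiv_mul, map_add]
  ring

theorem laplace_normSqPoly_mul {m : ℕ} {p : MvPolynomial σ ℝ} (hp : p.IsHomogeneous m) :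
    laplace (normSqPoly σ * p) =
      C (2 * Fintype.card σ + 4 * m : ℝ) * p + normSqPoly σ * laplace p := by
  have h2 : laplace (normSqPoly σ) = C (2 * Fintype.card σ : ℝ) := by
    have h (i : σ) : pderiv i (2 * X i : MvPolynomial σ ℝ) = C 2 := by
      rw [← map_ofNat (C : ℝ →+* MvPolynomial σ ℝ) 2, pderiv_C_mul, pderiv_X_self, mul_one]
    simp only [laplace_apply, pderiv_normSqPoly, h]
    simp [mul_comm]
  have hE := hp.sum_X_mul_pderiv
  rw [nsmul_eq_mul] at hE
  rw [laplace_mul, h2]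
  simp only [pderiv_normSqPoly, mul_assoc, ← Finset.mul_sum, hE]
  simp only [map_add, map_mul, map_ofNat, map_natCast]
  ring

theorem isHomogeneous_normSqPoly : (normSqPoly σ).IsHomogeneous 2 :=
  IsHomogeneous.sum _ _ _ fun i _ => by simpa using (isHomogeneous_X ℝ i).pow 2

theorem isHomogeneous_linForm (a : σ → ℝ) : (linForm a).IsHomogeneous 1 :=
  IsHomogeneous.sum _ _ _ fun i _ => by
    simpa using (isHomogeneous_C σ (a i)).mul (isHomogeneous_X ℝ i)

theorem laplace_normSqPoly_pow_succ_mul {m : ℕ} {q : MvPolynomial σ ℝ} (hq : q.IsHomogeneous m)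
    (j : ℕ) :
    laplace (normSqPoly σ ^ (j + 1) * q) =
      C (2 * (j + 1) * (Fintype.card σ + 2 * j + 2 * m) : ℝ) * (normSqPoly σ ^ j * q) +
        normSqPoly σ ^ (j + 1) * laplace q := by
  induction j with
  | zero =>
    simp only [zero_add, pow_one, pow_zero, one_mul, laplace_normSqPoly_mul hq]
    congr 3
    push_cast
    ring
  | succ j ih =>
    rw [pow_succ', mul_assoc,
      laplace_normSqPoly_mul ((isHomogeneous_normSqPoly.pow (j + 1)).mul hq), ih]
    simp only [map_add, map_mul, map_ofNat, map_natCast, map_one]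
    push_cast
    ring

theorem laplace_linForm_pow {a : σ → ℝ} (ha : ∑ i, a i ^ 2 = 1) (m : ℕ) :
    laplace (linForm a ^ m) = C (m * (m - 1) : ℝ) * linForm a ^ (m - 2) := by
  have hC : ∑ i, (C (a i) : MvPolynomial σ ℝ) ^ 2 = 1 := by
    simp_rw [← C_pow, ← map_sum, ha, C_1]
  have h1 (k : ℕ) (i : σ) : pderiv i (linForm a ^ (k + 1)) =
      C ((k + 1 : ℝ) * a i) * linForm a ^ k := by
    simp only [pderiv_pow, pderiv_linForm, Nat.add_sub_cancel, map_add, map_mul, map_natCast,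
      map_one]
    push_cast
    ring
  rcases m with _ | _ | m
  · simp [laplace_apply]
  · simp [laplace_apply, pderiv_linForm]
  · have h2 (i : σ) : pderiv i (pderiv i (linForm a ^ (m + 2))) =
        C ((m + 2) * (m + 1) : ℝ) * linForm a ^ m * C (a i) ^ 2 := by
      rw [h1 (m + 1), pderiv_C_mul, h1 m]
      simp only [map_add, map_mul, map_natCast, map_one, map_ofNat]
      push_cast
      ring
    simp only [laplace_apply, h2, ← Finset.mul_sum, hC, mul_one]
    congr 2
    push_cast
    ring

/-- Coefficients of the zonal harmonic polynomial of degree `k` in dimension `n`. -/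
noncomputable def zonalCoeff (n k : ℕ) : ℕ → ℝ
  | 0 => 1
  | j + 1 => -zonalCoeff n k j * ((k - 2 * j) * (k - 2 * j - 1)) /
      (2 * (j + 1) * (n + 2 * k - 2 * j - 4))

/-- The monic Gegenbauer polynomial of degree `k` for the sphere in dimension `n`. -/
noncomputable def zonal (n k : ℕ) (t : ℝ) : ℝ :=
  ∑ j ∈ Finset.range (k / 2 + 1), zonalCoeff n k j * t ^ (k - 2 * j)

/-- The zonal harmonic of degree `k` with pole `a`. -/
noncomputable def zonalPoly (a : σ → ℝ) (k : ℕ) : MvPolynomial σ ℝ :=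
  ∑ j ∈ Finset.range (k / 2 + 1),
    C (zonalCoeff (Fintype.card σ) k j) * (normSqPoly σ ^ j * linForm a ^ (k - 2 * j))

theorem isHomogeneous_zonalPoly (a : σ → ℝ) (k : ℕ) : (zonalPoly a k).IsHomogeneous k := by
  refine IsHomogeneous.sum _ _ _ fun j hj => ?_
  have hjk : 0 + (2 * j + 1 * (k - 2 * j)) = k := by
    have := Finset.mem_range.1 hj
    omega
  have := (isHomogeneous_C σ (zonalCoeff (Fintype.card σ) k j)).mul
    ((isHomogeneous_normSqPoly.pow j).mul ((isHomogeneous_linForm a).pow (k - 2 * j)))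
  rwa [hjk] at this

theorem eval_zonalPoly {a b : σ → ℝ} (hb : ∑ i, b i ^ 2 = 1) (k : ℕ) :
    eval b (zonalPoly a k) = zonal (Fintype.card σ) k (∑ i, a i * b i) := by
  simp [zonalPoly, zonal, normSqPoly, linForm, hb]

theorem laplace_zonalPoly (hσ : 3 ≤ Fintype.card σ) {a : σ → ℝ} (ha : ∑ i, a i ^ 2 = 1) (k : ℕ) :
    laplace (zonalPoly a k) = 0 := by
  set n := Fintype.card σ
  have hC (c : ℝ) (p : MvPolynomial σ ℝ) : laplace (C c * p) = C c * laplace p := by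
    rw [← smul_eq_C_mul, map_smul, smul_eq_C_mul]
  let u : ℕ → MvPolynomial σ ℝ := fun j =>
    C (zonalCoeff n k j * ((k - 2 * j) * (k - 2 * j - 1))) *
      (normSqPoly σ ^ j * linForm a ^ (k - 2 * j - 2))
  let v : ℕ → MvPolynomial σ ℝ := fun j => if j = 0 then 0 else u (j - 1)
  have hterm : ∀ j ∈ Finset.range (k / 2 + 1),
      laplace (C (zonalCoeff n k j) * (normSqPoly σ ^ j * linForm a ^ (k - 2 * j))) =
        u j - v j := by
    intro j hj
    have hjk : 2 * j ≤ k := by have := Finset.mem_range.1 hj; omega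
    have hcast : ((k - 2 * j : ℕ) : ℝ) = k - 2 * j := by push_cast [Nat.cast_sub hjk]; ring
    have hlin := laplace_linForm_pow ha (k - 2 * j)
    rw [hcast] at hlin
    rw [hC]
    rcases j with _ | j
    · simp only [pow_zero, one_mul, hlin, u, v, if_pos, sub_zero, map_mul]
      ring
    · have hhom : (linForm a ^ (k - 2 * (j + 1))).IsHomogeneous (k - 2 * (j + 1)) := by
        simpa using (isHomogeneous_linForm a).pow (k - 2 * (j + 1))
      rw [laplace_normSqPoly_pow_succ_mul hhom, hlin, hcast]
      have hden : (2 * (j + 1) * (n + 2 * k - 2 * j - 4) : ℝ) ≠ 0 := by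
        have h1 : (2 * (j + 1) : ℝ) ≤ k := by exact_mod_cast hjk
        have h2 : (3 : ℝ) ≤ n := by exact_mod_cast hσ
        have h3 : (0 : ℝ) ≤ j := Nat.cast_nonneg j
        have h4 : (0 : ℝ) < n + 2 * k - 2 * j - 4 := by linarith
        positivity
      have hrec : zonalCoeff n k (j + 1) * (2 * (j + 1) * (n + 2 * k - 2 * j - 4)) =
          -(zonalCoeff n k j * ((k - 2 * j) * (k - 2 * j - 1))) := by
        rw [zonalCoeff, div_mul_cancel₀ _ hden, neg_mul]
      have hrec' : (C (zonalCoeff n k (j + 1)) : MvPolynomial σ ℝ) *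
          C (2 * (j + 1) * (n + 2 * j + 2 * (k - 2 * ((j + 1 : ℕ) : ℝ)))) =
          -C (zonalCoeff n k j * ((k - 2 * j) * (k - 2 * j - 1))) := by
        rw [← C_mul, ← C_neg, ← hrec]
        congr 2
        push_cast
        ring
      have he : k - 2 * (j + 1) = k - 2 * j - 2 := by omega
      simp only [u, v, Nat.succ_ne_zero, if_false, Nat.add_sub_cancel]
      rw [mul_add, ← mul_assoc (C (zonalCoeff n k (j + 1))), hrec', he]
      simp only [map_mul]
      ring
  rw [zonalPoly, map_sum, Finset.sum_congr rfl hterm, Finset.sum_sub_distrib]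
  have hlast : u (k / 2) = 0 := by
    have h : ((k : ℝ) - 2 * (k / 2 : ℕ)) * (k - 2 * (k / 2 : ℕ) - 1) = 0 := by
      obtain ⟨m, hm | hm⟩ := Nat.even_or_odd' k
      · have : k / 2 = m := by omega
        rw [this, hm]; push_cast; ring
      · have : k / 2 = m := by omega
        rw [this, hm]; push_cast; ring
    simp only [u, h, mul_zero, C_0, zero_mul]
  rw [Finset.sum_range_succ u, hlast, Finset.sum_range_succ' v]
  simp [v]

theorem fischer_zonalPoly (hσ : 3 ≤ Fintype.card σ) {a b : σ → ℝ} (ha : ∑ i, a i ^ 2 = 1)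
    (hb : ∑ i, b i ^ 2 = 1) (k : ℕ) :
    fischer (zonalPoly b k) (zonalPoly a k) =
      k.factorial * zonal (Fintype.card σ) k (∑ i, a i * b i) := by
  rw [← eval_zonalPoly hb, ← fischer_linForm_pow b k (isHomogeneous_zonalPoly a k)]
  conv_lhs => rw [zonalPoly]
  rw [map_sum, LinearMap.sum_apply, Finset.sum_range_succ']
  have hz (j : ℕ) : fischer (C (zonalCoeff (Fintype.card σ) k (j + 1)) *
      (normSqPoly σ ^ (j + 1) * linForm b ^ (k - 2 * (j + 1)))) (zonalPoly a k) = 0 := by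
    rw [pow_succ', mul_assoc, mul_left_comm, fischer_normSqPoly_mul, laplace_zonalPoly hσ ha,
      map_zero]
  rw [Finset.sum_eq_zero fun j _ => hz j]
  simp [zonalCoeff]

/-- The Gegenbauer polynomials are positive definite on the sphere. -/
theorem sum_zonal_nonneg (hσ : 3 ≤ Fintype.card σ) {ι : Type*} [Fintype ι] {x : ι → σ → ℝ}
    (hx : ∀ i, ∑ s, x i s ^ 2 = 1) (k : ℕ) :
    0 ≤ ∑ i, ∑ j, zonal (Fintype.card σ) k (∑ s, x i s * x j s) := by
  have h := fischer_self_nonneg (∑ i, zonalPoly (x i) k)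
  simp only [map_sum, LinearMap.sum_apply, fischer_zonalPoly hσ (hx _) (hx _),
    ← Finset.mul_sum] at h
  exact nonneg_of_mul_nonneg_right h (by exact_mod_cast k.factorial_pos)

end MvPolynomial

/-- The auxiliary polynomial of the linear programming bound in dimension 26. -/
noncomputable def testPoly (t : ℝ) : ℝ :=
  (t + 70711 / 100000) * (t - 1 / 2) *
    ((t + 5197 / 10000) * (t + 47 / 125) * (t + 3 / 16) * (t - 69 / 2000) * (t - 2651 / 10000)) ^ 2 *
    (t ^ 3 - 1149 / 1000 * t ^ 2 - 661545 / 1000000 * t + 1274687 / 1000000)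

/-- The coefficients of `testPoly` in the basis of monic Gegenbauer polynomials. -/
noncomputable def testCoeff : Fin 16 → ℝ :=
  ![11692584461498019820875813151785389380143 / 3762304000000000000000000000000000000000000000,
    1064788895747617006184075225897358255201 / 17024000000000000000000000000000000000000000,
    360277483997696636879663552693612890521 / 608000000000000000000000000000000000000000,
    18808979052862033490386369852185578849451 / 5168000000000000000000000000000000000000000,
    2659930622635469818808807391930042386371 / 163200000000000000000000000000000000000000,
    51511299268354617695121517350250663877 / 912000000000000000000000000000000000000,
    47360991822001715011891642886556913 / 304000000000000000000000000000000000,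
    221735534053885935238971942969361 / 644000000000000000000000000000000,
    22364150986174450231307459 / 36800000000000000000000000,
    9395820038539500806310709 / 11500000000000000000000000,
    9110649603931783396811 / 11500000000000000000000,
    9719458776870439 / 25000000000000000,
    65963 / 156250000000,
    4493 / 6500000000,
    62531 / 100000,
    1]

theorem testCoeff_nonneg (k : Fin 16) : 0 ≤ testCoeff k := by
  fin_cases k <;> norm_num [testCoeff]

theorem testPoly_eq_sum (t : ℝ) :
    testPoly t = ∑ k : Fin 16, testCoeff k * MvPolynomial.zonal 26 k t := by
  simp only [Fin.sum_univ_succ, Fin.sum_univ_zero, MvPolynomial.zonal, testCoeff, testPoly]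
  norm_num [Finset.sum_range_succ, MvPolynomial.zonalCoeff, Fin.succ, Matrix.cons_val_zero]
  ring

theorem testPoly_nonpos {t : ℝ} (h₁ : -(70711 / 100000) ≤ t) (h₂ : t ≤ 1 / 2) : testPoly t ≤ 0 := by
  have ha : 0 ≤ t + 70711 / 100000 := by linarith
  have hb : 0 ≤ 1 / 2 - t := by linarith
  have hq : 0 ≤ t ^ 3 - 1149 / 1000 * t ^ 2 - 661545 / 1000000 * t + 1274687 / 1000000 := by
    have hc : 0 ≤ 1 - t := by linarith
    nlinarith [mul_nonneg (mul_nonneg ha hb) hc, mul_nonneg ha hb]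
  rw [testPoly]
  refine mul_nonpos_of_nonpos_of_nonneg (mul_nonpos_of_nonpos_of_nonneg ?_ (sq_nonneg _)) hq
  exact mul_nonpos_of_nonneg_of_nonpos ha (by linarith)

theorem testPoly_le_cap {t : ℝ} (h₁ : -1 ≤ t) (h₂ : t ≤ -(70711 / 100000)) :
    testPoly t ≤ 55211 / 25000000 * (2 * t ^ 2 - 1) := by
  obtain ⟨u, rfl⟩ : ∃ u, t = -(70711 / 100000) - u := ⟨-(70711 / 100000) - t, by ring⟩
  have hu : 0 ≤ u := by linarith
  have hu' : u ≤ 1 - 70711 / 100000 := by linarith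
  have key : 55211 / 25000000 * (2 * (-(70711 / 100000) - u) ^ 2 - 1) - testPoly (-(70711 / 100000) - u) =
      u * ((u - 18613 / 100000) ^ 2 * (164749746926490790760968769093616367900904225104061317341477 / 1000000000000000000000000000000000000000000000000000000000000 +
      77187036314831468413593064244454776946672356844499959 / 50000000000000000000000000000000000000000000000000000 * u +
      427418814959815283613811897970514521274663255776223 / 50000000000000000000000000000000000000000000000000 * u ^ 2 +
      102936286556853488332619526192666651258484671 / 3125000000000000000000000000000000000000000 * u ^ 3 +
      36696714680709940187292333457252741752687 / 400000000000000000000000000000000000000 * u ^ 4 +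
      1169555371364654317483937838893975193 / 6250000000000000000000000000000000 * u ^ 5 +
      70081677581550614574943660173861 / 250000000000000000000000000000 * u ^ 6 +
      95845807884877451763001801 / 312500000000000000000000 * u ^ 7 +
      24132600086888649460899 / 100000000000000000000 * u ^ 8 +
      16568062340196647 / 125000000000000 * u ^ 9 +
      240552766471 / 5000000000 * u ^ 10 +
      6471 / 625 * u ^ 11 +
      1 * u ^ 12) +
      (285360751839483510902663334226831867189194937299702214389257 / 38146972656250000000000000000000000000000000000000000000000000000 - 7049852553271811122904493641904324562476313968250546121 / 381469726562500000000000000000000000000000000000000000000000 * u)) + 2513259931 / 125000000000000000 := by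
    rw [testPoly]
    ring
  have hlin : 0 ≤ 285360751839483510902663334226831867189194937299702214389257 / 38146972656250000000000000000000000000000000000000000000000000000 - 7049852553271811122904493641904324562476313968250546121 / 381469726562500000000000000000000000000000000000000000000000 * u := by linarith
  have : 0 ≤ 55211 / 25000000 * (2 * (-(70711 / 100000) - u) ^ 2 - 1) - testPoly (-(70711 / 100000) - u) := by
    rw [key]
    positivity
  linarith

/-- Unit vectors `y i` at mutual angles at least `π / 3` cannot all be close to `-z`. -/
theorem sum_two_mul_inner_sq_sub_one_le {E ι : Type*} [NormedAddCommGroup E]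
    [InnerProductSpace ℝ E] {z : E} (hz : ‖z‖ = 1) {y : ι → E} (hy : ∀ i, ‖y i‖ = 1)
    (hsep : ∀ i j, i ≠ j → ⟪y i, y j⟫ ≤ 1 / 2) (s : Finset ι)
    (hs : ∀ i ∈ s, ⟪z, y i⟫ ≤ 0) :
    ∑ i ∈ s, (2 * ⟪z, y i⟫ ^ 2 - 1) ≤ 1 := by
  classical
  set a : ι → ℝ := fun i => ⟪z, y i⟫
  set S := ∑ i ∈ s, a i ^ 2
  have hS : 0 ≤ S := Finset.sum_nonneg fun i _ => sq_nonneg _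
  have hproj : S ^ 2 ≤ ‖∑ i ∈ s, a i • y i‖ ^ 2 := by
    have h : ⟪z, ∑ i ∈ s, a i • y i⟫ = S := by
      simp only [inner_sum, inner_smul_right, S, pow_two, a]
    have h' := real_inner_le_norm z (∑ i ∈ s, a i • y i)
    rw [h, hz, one_mul] at h'
    gcongr
  have hnorm : ‖∑ i ∈ s, a i • y i‖ ^ 2 ≤ S / 2 + (∑ i ∈ s, a i) ^ 2 / 2 := by
    have hterm : ∀ i ∈ s, ∀ j ∈ s, a i * (a j * ⟪y i, y j⟫) ≤
        a i * a j / 2 + if i = j then a i ^ 2 / 2 else 0 := by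
      intro i hi j hj
      have h0 : 0 ≤ a i * a j := mul_nonneg_of_nonpos_of_nonpos (hs i hi) (hs j hj)
      split_ifs with hij
      · subst hij
        rw [real_inner_self_eq_norm_sq, hy]
        linarith
      · nlinarith [hsep i j hij]
    have hsum : (∑ i ∈ s, a i) ^ 2 / 2 + S / 2 =
        ∑ i ∈ s, ∑ j ∈ s, (a i * a j / 2 + if i = j then a i ^ 2 / 2 else 0) := by
      simp only [Finset.sum_add_distrib, ← Finset.sum_div, Finset.sum_ite_eq, pow_two,
        Finset.sum_mul_sum, S]
      congr 1
      rw [Finset.sum_div]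
      exact Finset.sum_congr rfl fun i hi => by simp [hi]
    rw [← real_inner_self_eq_norm_sq, add_comm, hsum]
    simp only [sum_inner, inner_sum, real_inner_smul_left, real_inner_smul_right]
    refine Finset.sum_le_sum fun i hi => Finset.sum_le_sum fun j hj => ?_
    rw [real_inner_comm]
    exact hterm i hi j hj
  have hcs : (∑ i ∈ s, a i) ^ 2 ≤ s.card * S := sq_sum_le_card_mul_sum_sq
  have hgoal : ∑ i ∈ s, (2 * a i ^ 2 - 1) = 2 * S - s.card := by
    simp [Finset.sum_sub_distrib, ← Finset.mul_sum, S]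
  rw [hgoal]
  rcases hS.eq_or_lt with h0 | h0
  · rw [← h0]
    have : (0 : ℝ) ≤ s.card := Nat.cast_nonneg _
    linarith
  · have : S * (2 * S - s.card - 1) ≤ 0 := by nlinarith
    have := nonpos_of_mul_nonpos_right this h0
    linarith

/-- The kissing number in dimension 26 is at most 396447. -/
theorem kissing_dim26_le (N : ℕ)
    (x : Fin N → EuclideanSpace ℝ (Fin 26))
    (hx : ∀ i, ‖x i‖ = 1)
    (hsep : ∀ i j, i ≠ j → ⟪x i, x j⟫ ≤ 1 / 2) :
    N ≤ 396447 := by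
  rcases N.eq_zero_or_pos with rfl | hN
  · simp
  have hrow (i : Fin N) : ∑ j, testPoly ⟪x i, x j⟫ ≤ testPoly 1 + 55211 / 25000000 := by
    set s := (Finset.univ.erase i).filter fun j => ⟪x i, x j⟫ < -(70711 / 100000)
    have hterm : ∀ j ∈ Finset.univ.erase i, testPoly ⟪x i, x j⟫ ≤
        if ⟪x i, x j⟫ < -(70711 / 100000) then 55211 / 25000000 * (2 * ⟪x i, x j⟫ ^ 2 - 1) else 0 := by
      intro j hj
      split_ifs with h
      · refine testPoly_le_cap ?_ h.le
        have := neg_le_of_abs_le (abs_real_inner_le_norm (x i) (x j))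
        simpa [hx] using this
      · exact testPoly_nonpos (not_lt.1 h) (hsep i j (Finset.ne_of_mem_erase hj).symm)
    have hcap := sum_two_mul_inner_sq_sub_one_le (hx i) hx hsep s fun j hj => by
      have := (Finset.mem_filter.1 hj).2
      linarith
    rw [← Finset.add_sum_erase _ _ (Finset.mem_univ i), real_inner_self_eq_norm_sq, hx, one_pow]
    have hsum := Finset.sum_le_sum hterm
    rw [← Finset.sum_filter, ← Finset.mul_sum] at hsum
    linarith
  have hzonal (k : ℕ) : 0 ≤ ∑ i, ∑ j, MvPolynomial.zonal 26 k ⟪x i, x j⟫ := by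
    have hunit (i : Fin N) : ∑ s, (x i).ofLp s ^ 2 = 1 := by
      rw [← EuclideanSpace.real_norm_sq_eq, hx, one_pow]
    have h := MvPolynomial.sum_zonal_nonneg (σ := Fin 26) (by simp) hunit k
    simpa [PiLp.inner_apply, mul_comm] using h
  have hlower : testCoeff 0 * (N : ℝ) ^ 2 ≤ ∑ i, ∑ j, testPoly ⟪x i, x j⟫ := by
    have h : ∑ i, ∑ j, testPoly ⟪x i, x j⟫ =
        ∑ k : Fin 16, testCoeff k * ∑ i, ∑ j, MvPolynomial.zonal 26 k ⟪x i, x j⟫ := by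
      simp only [testPoly_eq_sum, Finset.mul_sum]
      exact (Finset.sum_congr rfl fun i _ => Finset.sum_comm).trans Finset.sum_comm
    have h0 : ∑ i, ∑ j, MvPolynomial.zonal 26 ((0 : Fin 16) : ℕ) ⟪x i, x j⟫ = (N : ℝ) ^ 2 := by
      simp [MvPolynomial.zonal, MvPolynomial.zonalCoeff, pow_two]
    rw [h, ← h0]
    exact Finset.single_le_sum (f := fun k : Fin 16 =>
      testCoeff k * ∑ i, ∑ j, MvPolynomial.zonal 26 k ⟪x i, x j⟫)
      (fun k _ => mul_nonneg (testCoeff_nonneg k) (hzonal k)) (Finset.mem_univ 0)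
  have hupper : ∑ i, ∑ j, testPoly ⟪x i, x j⟫ ≤ N * (testPoly 1 + 55211 / 25000000) := by
    exact (Finset.sum_le_sum fun i _ => hrow i).trans_eq (by simp [mul_add])
  have hconst : testPoly 1 + 55211 / 25000000 < testCoeff 0 * 396448 := by
    norm_num [testPoly, testCoeff]
  have hNpos : (0 : ℝ) < N := by exact_mod_cast hN
  have h0 : 0 < testCoeff 0 := by norm_num [testCoeff]
  have hlt : (N : ℝ) < 396448 := by
    by_contra! hge
    have := mul_le_mul_of_nonneg_left hge (mul_nonneg h0.le hNpos.le)
    nlinarith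
  have : N < 396448 := by exact_mod_cast hlt
  omega
end

section
/- The kissing number in dimension 3 is at most 12: every finite set of unit vectors x_1, …, x_N in ℝ^{3} satisfying ⟨x_i, x_j⟩ ≤ 1/2 for all i ≠ j has N ≤ 12. -/
open scoped RealInnerProductSpace BigOperators

open ComplexConjugate

/-! ### Polar coordinates around a point of the sphere -/

/-- Around a unit vector `e` of three-dimensional space, the component orthogonal to `e` can be
read as a complex number. -/
theorem exists_polar_coordinates {e : EuclideanSpace ℝ (Fin 3)} (he : ‖e‖ = 1) :
    ∃ φ : EuclideanSpace ℝ (Fin 3) → ℂ,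
      ∀ x y, ⟪x, y⟫ = ⟪e, x⟫ * ⟪e, y⟫ + (φ x * conj (φ y)).re := by
  obtain ⟨b, hb⟩ := Orthonormal.exists_orthonormalBasis_extension_of_card_eq (𝕜 := ℝ)
    (E := EuclideanSpace ℝ (Fin 3)) (ι := Fin 3) (by simp) (v := fun _ => e) (s := {0})
    ⟨fun _ => he, fun i j hij => absurd (Subsingleton.elim i j) hij⟩
  refine ⟨fun x => ⟨⟪b 1, x⟫, ⟪b 2, x⟫⟩, fun x y => ?_⟩
  rw [← b.sum_inner_mul_inner x y, Fin.sum_univ_three, hb 0 rfl]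
  simp only [real_inner_comm x]
  simp [add_assoc]

theorem sum_mul_pow_mul_conj_pow_nonneg {ι : Type*} [Fintype ι] (a : ι → ℝ) (z : ι → ℂ) (m : ℕ) :
    0 ≤ ∑ i, ∑ j, a i * a j * ((z i * conj (z j)) ^ m).re := by
  have h : ∑ i, ∑ j, a i * a j * ((z i * conj (z j)) ^ m).re =
      Complex.normSq (∑ i, a i * z i ^ m) := by
    rw [← Complex.ofReal_re (Complex.normSq _), Complex.normSq_eq_conj_mul_self, mul_comm,
      map_sum, Finset.sum_mul_sum, Complex.re_sum]
    refine Finset.sum_congr rfl fun i _ => ?_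
    rw [Complex.re_sum]
    refine Finset.sum_congr rfl fun j _ => ?_
    rw [← Complex.re_ofReal_mul, mul_pow, map_mul, map_pow, Complex.conj_ofReal]
    push_cast
    ring_nf
  exact h ▸ Complex.normSq_nonneg _

/-- The polynomial in `τ = Re ζ` and `ρ = |ζ|²` that equals `Re (ζ ^ m)`. -/
def scaledChebyshev (τ ρ : ℝ) : ℕ → ℝ
  | 0 => 1
  | 1 => τ
  | m + 2 => 2 * τ * scaledChebyshev τ ρ (m + 1) - ρ * scaledChebyshev τ ρ m

theorem re_pow_eq_scaledChebyshev (ζ : ℂ) :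
    ∀ m, (ζ ^ m).re = scaledChebyshev ζ.re (Complex.normSq ζ) m
  | 0 => by simp [scaledChebyshev]
  | 1 => by simp [scaledChebyshev]
  | m + 2 => by
    rw [scaledChebyshev, ← re_pow_eq_scaledChebyshev ζ (m + 1), ← re_pow_eq_scaledChebyshev ζ m]
    simp only [pow_succ, Complex.mul_re, Complex.mul_im, Complex.normSq_apply]
    ring

/-- A function with an addition formula with nonnegative coefficients is positive definite on the
two-dimensional sphere. -/
theorem sum_kernel_nonneg {g : ℝ → ℝ} {n : ℕ} (c : Fin n → ℝ) (Q : Fin n → ℝ → ℝ)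
    (hc : ∀ m, 0 ≤ c m)
    (hg : ∀ u v τ, g (u * v + τ) =
      ∑ m, c m * (Q m u * Q m v * scaledChebyshev τ ((1 - u ^ 2) * (1 - v ^ 2)) m))
    {ι : Type*} [Fintype ι] {x : ι → EuclideanSpace ℝ (Fin 3)} (hx : ∀ i, ‖x i‖ = 1) :
    0 ≤ ∑ i, ∑ j, g ⟪x i, x j⟫ := by
  obtain ⟨φ, hφ⟩ := exists_polar_coordinates
    (e := EuclideanSpace.single 0 1) (by simp)
  set e : EuclideanSpace ℝ (Fin 3) := EuclideanSpace.single 0 1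
  have hnorm (i : ι) : Complex.normSq (φ (x i)) = 1 - ⟪e, x i⟫ ^ 2 := by
    have h := hφ (x i) (x i)
    rw [real_inner_self_eq_norm_sq, hx, Complex.mul_conj, Complex.ofReal_re] at h
    linarith
  have hkernel (i j : ι) : g ⟪x i, x j⟫ = ∑ m, c m * (Q m ⟪e, x i⟫ * Q m ⟪e, x j⟫ *
      ((φ (x i) * conj (φ (x j))) ^ (m : ℕ)).re) := by
    simp only [hφ (x i) (x j), hg, re_pow_eq_scaledChebyshev, Complex.normSq_mul,
      Complex.normSq_conj, hnorm]
  have hswap : ∑ i, ∑ j, g ⟪x i, x j⟫ = ∑ m, c m * ∑ i, ∑ j, Q m ⟪e, x i⟫ * Q m ⟪e, x j⟫ *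
      ((φ (x i) * conj (φ (x j))) ^ (m : ℕ)).re := by
    simp only [hkernel, Finset.mul_sum]
    rw [Finset.sum_comm]
    simp only [fun j => Finset.sum_comm (s := Finset.univ) (t := Finset.univ (α := Fin n))
      (f := fun i m => c m * (Q m ⟪e, x i⟫ * Q m ⟪e, x j⟫ *
        ((φ (x i) * conj (φ (x j))) ^ (m : ℕ)).re))]
    rw [Finset.sum_comm]
    exact Finset.sum_congr rfl fun m _ => Finset.sum_comm
  rw [hswap]
  exact Finset.sum_nonneg fun m _ => mul_nonneg (hc m)
    (sum_mul_pow_mul_conj_pow_nonneg (fun i => Q m ⟪e, x i⟫) (fun i => φ (x i)) m)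

/-! ### Legendre polynomials -/

noncomputable def legendreOne (t : ℝ) : ℝ := t

noncomputable def legendreTwo (t : ℝ) : ℝ := 3/2 * t ^ 2 - 1/2

noncomputable def legendreThree (t : ℝ) : ℝ := 5/2 * t ^ 3 - 3/2 * t

noncomputable def legendreFour (t : ℝ) : ℝ := 35/8 * t ^ 4 - 15/4 * t ^ 2 + 3/8

noncomputable def legendreNine (t : ℝ) : ℝ :=
  12155/128 * t ^ 9 - 6435/32 * t ^ 7 + 9009/64 * t ^ 5 - 1155/32 * t ^ 3 + 315/128 * t

theorem sum_legendre_one_nonneg {ι : Type*} [Fintype ι] {x : ι → EuclideanSpace ℝ (Fin 3)}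
    (hx : ∀ i, ‖x i‖ = 1) :
    0 ≤ ∑ i, ∑ j, legendreOne ⟪x i, x j⟫ := by
  refine sum_kernel_nonneg (n := 2) ![1, 1]
    ![fun u => u,
      fun _ => 1]
    (fun m => by fin_cases m <;> norm_num) (fun u v τ => ?_) hx
  simp only [Fin.sum_univ_succ, legendreOne, scaledChebyshev]
  simp [scaledChebyshev]

theorem sum_legendre_two_nonneg {ι : Type*} [Fintype ι] {x : ι → EuclideanSpace ℝ (Fin 3)}
    (hx : ∀ i, ‖x i‖ = 1) :
    0 ≤ ∑ i, ∑ j, legendreTwo ⟪x i, x j⟫ := by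
  refine sum_kernel_nonneg (n := 3) ![1/4, 3, 3/4]
    ![fun u => 3 * u ^ 2 - 1,
      fun u => u,
      fun _ => 1]
    (fun m => by fin_cases m <;> norm_num) (fun u v τ => ?_) hx
  simp only [Fin.sum_univ_succ, legendreTwo, scaledChebyshev]
  simp [scaledChebyshev]
  ring

theorem sum_legendre_three_nonneg {ι : Type*} [Fintype ι] {x : ι → EuclideanSpace ℝ (Fin 3)}
    (hx : ∀ i, ‖x i‖ = 1) :
    0 ≤ ∑ i, ∑ j, legendreThree ⟪x i, x j⟫ := by
  refine sum_kernel_nonneg (n := 4) ![1/4, 3/8, 15/4, 5/8]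
    ![fun u => 5 * u ^ 3 - 3 * u,
      fun u => 5 * u ^ 2 - 1,
      fun u => u,
      fun _ => 1]
    (fun m => by fin_cases m <;> norm_num) (fun u v τ => ?_) hx
  simp only [Fin.sum_univ_succ, legendreThree, scaledChebyshev]
  simp [scaledChebyshev]
  ring

theorem sum_legendre_four_nonneg {ι : Type*} [Fintype ι] {x : ι → EuclideanSpace ℝ (Fin 3)}
    (hx : ∀ i, ‖x i‖ = 1) :
    0 ≤ ∑ i, ∑ j, legendreFour ⟪x i, x j⟫ := by
  refine sum_kernel_nonneg (n := 5) ![1/64, 5/8, 5/16, 35/8, 35/64]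
    ![fun u => 35 * u ^ 4 - 30 * u ^ 2 + 3,
      fun u => 7 * u ^ 3 - 3 * u,
      fun u => 7 * u ^ 2 - 1,
      fun u => u,
      fun _ => 1]
    (fun m => by fin_cases m <;> norm_num) (fun u v τ => ?_) hx
  simp only [Fin.sum_univ_succ, legendreFour, scaledChebyshev]
  simp [scaledChebyshev]
  ring

theorem sum_legendre_nine_nonneg {ι : Type*} [Fintype ι] {x : ι → EuclideanSpace ℝ (Fin 3)}
    (hx : ∀ i, ‖x i‖ = 1) :
    0 ≤ ∑ i, ∑ j, legendreNine ⟪x i, x j⟫ := by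
  refine sum_kernel_nonneg (n := 10)
    ![1/16384, 45/16384, 495/2048, 1155/8192, 45045/4096, 1287/8192, 2145/2048, 6435/32768,
      109395/16384, 12155/32768]
    ![fun u => 12155 * u ^ 9 - 25740 * u ^ 7 + 18018 * u ^ 5 - 4620 * u ^ 3 + 315 * u,
      fun u => 2431 * u ^ 8 - 4004 * u ^ 6 + 2002 * u ^ 4 - 308 * u ^ 2 + 7,
      fun u => 221 * u ^ 7 - 273 * u ^ 5 + 91 * u ^ 3 - 7 * u,
      fun u => 221 * u ^ 6 - 195 * u ^ 4 + 39 * u ^ 2 - 1,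
      fun u => 17 * u ^ 5 - 10 * u ^ 3 + u,
      fun u => 85 * u ^ 4 - 30 * u ^ 2 + 1,
      fun u => 17 * u ^ 3 - 3 * u,
      fun u => 17 * u ^ 2 - 1,
      fun u => u,
      fun _ => 1]
    (fun m => by fin_cases m <;> norm_num) (fun u v τ => ?_) hx
  simp only [Fin.sum_univ_succ, legendreNine, scaledChebyshev]
  simp [scaledChebyshev]
  ring

/-! ### The test function -/

noncomputable def testFunction (t : ℝ) : ℝ :=
  1 + 299/200 * legendreOne t + 349/100 * legendreTwo t + 1541/1000 * legendreThree t +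
    1971/1000 * legendreFour t + 129/500 * legendreNine t

theorem le_of_bernstein_form (c : Fin 10 → ℝ) {a b l r t : ℝ} (hc : ∀ m, 0 ≤ c m)
    (hl : l ≤ t) (hr : t ≤ r)
    (h : b - a = ∑ m : Fin 10, c m * (t - l) ^ (m : ℕ) * (r - t) ^ (9 - m : ℕ)) : a ≤ b := by
  rw [← sub_nonneg, h]
  exact Finset.sum_nonneg fun m _ => mul_nonneg
    (mul_nonneg (hc m) (pow_nonneg (sub_nonneg.2 hl) _)) (pow_nonneg (sub_nonneg.2 hr) _)

theorem testFunction_nonpos {t : ℝ} (hl : -29/50 ≤ t) (hr : t ≤ 1/2) :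
    testFunction t ≤ 0 := by
  rcases le_total t (-33/100) with h₁ | h₁
  · refine le_of_bernstein_form ![
        124709016367972531/95367431640625, 6902423765396011783/190734863281250,
        13860679506379110391/95367431640625, 45515294834204866383/190734863281250,
        141252197604412278773/762939453125000, 91246577174068774121/1525878906250000,
        3728272744034442339/1525878906250000, 7629239659491046387/3051757812500000,
        93190402551379912699/24414062500000000, 44254552373069218847/48828125000000000]
      (l := -29/50) (r := -33/100)
      (fun m => by fin_cases m <;> norm_num) hl h₁ ?_
    simp [Fin.sum_univ_succ, testFunction, legendreOne, legendreTwo, legendreThree, legendreFour,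
      legendreNine]
    ring
  rcases le_total t (-7/200) with h₂ | h₂
  · refine le_of_bernstein_form ![
        44254552373069218847/216574895466373475,
        1296689935076722959617/433149790932746950,
        3905751437579159932343/216574895466373475,
        23290480154704169024493/433149790932746950,
        147200925086978799851041/1732599163730987800,
        248363688158758635172039/3465198327461975600,
        103937150819108385248427/3465198327461975600,
        32792187801841521849857/6930396654923951200,
        6325607163642980993303/55443173239391609600,
        12557037241555412561593/110886346478783219200] (l := -33/100) (r := -7/200)
      (fun m => by fin_cases m <;> norm_num) h₁ h₂ ?_
    simp [Fin.sum_univ_succ, testFunction, legendreOne, legendreTwo, legendreThree, legendreFour,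
      legendreNine]
    ring
  · refine le_of_bernstein_form ![
        12557037241555412561593/23532277918977977689600,
        2950259950146472616009/235322779189779776896,
        2992333208033134413925/14707673699361236056,
        5086731565625864165625/3676918424840309014,
        8474077774324654334375/1838459212420154507,
        15036396506705485937500/1838459212420154507,
        14237450779090312500000/1838459212420154507,
        6655392250656250000000/1838459212420154507,
        1217614658281250000000/1838459212420154507,
        920328125000000000/1838459212420154507] (l := -7/200) (r := 1/2)
      (fun m => by fin_cases m <;> norm_num) h₂ hr ?_
    simp [Fin.sum_univ_succ, testFunction, legendreOne, legendreTwo, legendreThree, legendreFour,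
      legendreNine]
    ring

theorem testFunction_le_low {t : ℝ} (hl : -17/25 ≤ t) (hr : t ≤ -29/50) :
    testFunction t ≤ 321/250 * -t - 7447/10000 := by
  refine le_of_bernstein_form ![
      66126910463328/48828125, 7353806454877312/48828125, 47746351749407888/48828125,
      136107556055674032/48828125, 434835094639720501/97656250,
      210068221597904653/48828125, 987234097173022821/390625000,
      332089807522777079/390625000, 1702674426578625767/12500000000,
      125209016367972531/25000000000] (l := -17/25) (r := -29/50)
    (fun m => by fin_cases m <;> norm_num) hl hr ?_
  simp [Fin.sum_univ_succ, testFunction, legendreOne, legendreTwo, legendreThree, legendreFour,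
    legendreNine]
  ring

theorem testFunction_le_middle {t : ℝ} (hl : -4/5 ≤ t) (hr : t ≤ -17/25) :
    testFunction t ≤ 1357/250 * -t - 35627/10000 := by
  refine le_of_bernstein_form ![
      629717890625/2519424, 263698796703125/3359232, 224574767534375/419904,
      658584651348125/419904, 1071791856478625/419904, 1044943989924175/419904,
      25445605443905/17496, 24807017098181/52488, 34855914231919/524880,
      1944395639479/7873200] (l := -4/5) (r := -17/25)
    (fun m => by fin_cases m <;> norm_num) hl hr ?_
  simp [Fin.sum_univ_succ, testFunction, legendreOne, legendreTwo, legendreThree, legendreFour,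
    legendreNine]
  ring

theorem testFunction_le_high {t : ℝ} (hl : -1 ≤ t) (hr : t ≤ -4/5) :
    testFunction t ≤ 3071/250 * -t - 3619/400 := by
  rcases le_total t (-24/25) with h₁ | h₁
  · refine le_of_bernstein_form ![
        4241943359375/16, 27301025390625/16, 37228271484375/8, 55440986328125/8,
        385210517578125/64, 190651743346875/64, 47282008049375/64, 4596956643525/64,
        9674137408791/512, 3219037103943/400] (l := -1) (r := -24/25)
      (fun m => by fin_cases m <;> norm_num) hl h₁ ?_
    simp [Fin.sum_univ_succ, testFunction, legendreOne, legendreTwo, legendreThree, legendreFour,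
      legendreNine]
    ring
  · refine le_of_bernstein_form ![
        3219037103943/104857600, 183399984439941/167772160, 85902475272093/4194304,
        785140723380695/8388608, 835053306630825/4194304, 3911941012855875/16777216,
        653680023141875/4194304, 470377838784375/8388608, 4455473109375/524288,
        629717890625/33554432] (l := -24/25) (r := -4/5)
      (fun m => by fin_cases m <;> norm_num) h₁ hr ?_
    simp [Fin.sum_univ_succ, testFunction, legendreOne, legendreTwo, legendreThree, legendreFour,
      legendreNine]
    ring

/-! ### Points near the antipode -/

/-- At most four unit vectors of the plane have pairwise inner products at most `1 / 4`. -/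
theorem card_le_four_of_unit_complex {ι : Type*} [Fintype ι] {w : ι → ℂ} (hw : ∀ i, ‖w i‖ = 1)
    (hsep : ∀ i j, i ≠ j → (w i * conj (w j)).re ≤ 1 / 4) : Fintype.card ι ≤ 4 := by
  classical
  let q : ℝ → ℝ := fun c => (c - 1 / 4) * (c + 3 / 4) ^ 2
  have hq (i j : ι) : q (w i * conj (w j)).re = 31 / 64 * ((w i * conj (w j)) ^ 0).re +
      15 / 16 * ((w i * conj (w j)) ^ 1).re +
      5 / 8 * ((w i * conj (w j)) ^ 2).re +
      1 / 4 * ((w i * conj (w j)) ^ 3).re := by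
    have h : Complex.normSq (w i * conj (w j)) = 1 := by
      simp [Complex.normSq_eq_norm_sq, hw]
    simp only [re_pow_eq_scaledChebyshev, h, scaledChebyshev, q]
    ring
  have hlower : 31 / 64 * (Fintype.card ι : ℝ) ^ 2 ≤ ∑ i, ∑ j, q (w i * conj (w j)).re := by
    have h (m : ℕ) : 0 ≤ ∑ i, ∑ j, ((w i * conj (w j)) ^ m).re := by
      simpa using sum_mul_pow_mul_conj_pow_nonneg (fun _ => 1) w m
    simp only [hq, Finset.sum_add_distrib, ← Finset.mul_sum]
    have h0 : ∑ i : ι, ∑ j : ι, ((w i * conj (w j)) ^ 0).re =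
        (Fintype.card ι : ℝ) ^ 2 := by
      simp [sq]
    rw [h0]
    linarith [h 1, h 2, h 3]
  have hupper : ∑ i, ∑ j, q (w i * conj (w j)).re ≤ ∑ _i : ι, 147 / 64 := by
    refine Finset.sum_le_sum fun i _ => ?_
    rw [← Finset.add_sum_erase _ _ (Finset.mem_univ i)]
    have hii : q (w i * conj (w i)).re = 147 / 64 := by
      rw [Complex.mul_conj, Complex.ofReal_re, Complex.normSq_eq_norm_sq, hw]
      norm_num [q]
    have hij : ∑ j ∈ Finset.univ.erase i, q (w i * conj (w j)).re ≤ 0 :=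
      Finset.sum_nonpos fun j hj => mul_nonpos_of_nonpos_of_nonneg
        (sub_nonpos.2 (hsep i j (Finset.ne_of_mem_erase hj).symm)) (sq_nonneg _)
    linarith
  rw [Finset.sum_const, Finset.card_univ, nsmul_eq_mul] at hupper
  by_contra! hcard
  have hcard' : (5 : ℝ) ≤ Fintype.card ι := by exact_mod_cast hcard
  nlinarith

theorem half_sub_mul_le {u v : ℝ} (hu : 29 / 50 ≤ u) (hv : 29 / 50 ≤ v) (huv : u * v ≤ 1 / 2) :
    (1 / 2 - u * v) ^ 2 ≤ (1 / 4) ^ 2 * ((1 - u ^ 2) * (1 - v ^ 2)) := by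
  have hp : 841 / 2500 ≤ u * v := by nlinarith
  have hsum : 841 / 2500 * (u ^ 2 + v ^ 2) ≤ (u * v) ^ 2 + (841 / 2500) ^ 2 := by
    have hu2 : 841 / 2500 ≤ u ^ 2 := by nlinarith
    have hv2 : 841 / 2500 ≤ v ^ 2 := by nlinarith
    nlinarith [mul_nonneg (sub_nonneg.2 hu2) (sub_nonneg.2 hv2)]
  have hprod : (1 - u ^ 2) * (1 - v ^ 2) = 1 - (u ^ 2 + v ^ 2) + (u * v) ^ 2 := by ring
  rw [hprod]
  nlinarith [mul_nonneg (sub_nonneg.2 hp) (sub_nonneg.2 huv)]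

/-- At most four points of a kissing configuration lie in the cap of height `29 / 50`. -/
theorem card_cap_le_four {ι : Type*} [Fintype ι] {e : EuclideanSpace ℝ (Fin 3)}
    {y : ι → EuclideanSpace ℝ (Fin 3)} (he : ‖e‖ = 1) (hy : ∀ i, ‖y i‖ = 1)
    (hsep : ∀ i j, i ≠ j → ⟪y i, y j⟫ ≤ 1 / 2) (hcap : ∀ i, 29 / 50 ≤ ⟪e, y i⟫) :
    Fintype.card ι ≤ 4 := by
  by_contra! hcard
  have : Nontrivial ι := Fintype.one_lt_card_iff_nontrivial.1 (by omega)
  obtain ⟨φ, hφ⟩ := exists_polar_coordinates he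
  have hle (i : ι) : ⟪e, y i⟫ ≤ 1 := by
    simpa [he, hy] using real_inner_le_norm e (y i)
  have hnorm (i : ι) : ‖φ (y i)‖ ^ 2 = 1 - ⟪e, y i⟫ ^ 2 := by
    have h := hφ (y i) (y i)
    rw [real_inner_self_eq_norm_sq, hy, Complex.mul_conj, Complex.ofReal_re,
      Complex.normSq_eq_norm_sq] at h
    linarith
  have hne (i : ι) : φ (y i) ≠ 0 := by
    intro h0
    obtain ⟨j, hj⟩ := exists_ne i
    have h := hφ (y i) (y j)
    have hi := hnorm i
    rw [h0] at h hi
    simp only [zero_mul, Complex.zero_re, add_zero, norm_zero] at h hi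
    nlinarith [hsep i j hj.symm, hcap i, hcap j, hle i]
  refine hcard.not_ge (card_le_four_of_unit_complex (w := fun i => φ (y i) / ‖φ (y i)‖)
    (fun i => by simp [hne i]) fun i j hij => ?_)
  have hpos : 0 < ‖φ (y i)‖ * ‖φ (y j)‖ :=
    mul_pos (norm_pos_iff.2 (hne i)) (norm_pos_iff.2 (hne j))
  have hdiv : φ (y i) / ‖φ (y i)‖ * conj (φ (y j) / ‖φ (y j)‖) =
      φ (y i) * conj (φ (y j)) / ((‖φ (y i)‖ * ‖φ (y j)‖ : ℝ) : ℂ) := by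
    simp [div_mul_div_comm]
  rw [hdiv, Complex.div_ofReal_re, div_le_iff₀ hpos]
  have hre : (φ (y i) * conj (φ (y j))).re ≤ 1 / 2 - ⟪e, y i⟫ * ⟪e, y j⟫ := by
    linarith [hφ (y i) (y j), hsep i j hij]
  refine hre.trans ?_
  rcases le_total (⟪e, y i⟫ * ⟪e, y j⟫) (1 / 2) with h | h
  · refine le_of_sq_le_sq ?_ (by positivity)
    rw [mul_pow, mul_pow, hnorm, hnorm]
    exact half_sub_mul_le (hcap i) (hcap j) h
  · linarith

theorem sum_mul_inner_le {ι : Type*} [Fintype ι] {E : Type*} [NormedAddCommGroup E]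
    [InnerProductSpace ℝ E] {e : E} {y : ι → E} (he : ‖e‖ = 1) (hy : ∀ i, ‖y i‖ = 1)
    (hsep : ∀ i j, i ≠ j → ⟪y i, y j⟫ ≤ 1 / 2) {a : ι → ℝ} (ha : ∀ i, 0 ≤ a i) {D : ℝ}
    (hD : 0 ≤ D) (hle : 1 / 2 * ∑ i, a i ^ 2 + 1 / 2 * (∑ i, a i) ^ 2 ≤ D ^ 2) :
    ∑ i, a i * ⟪e, y i⟫ ≤ D := by
  classical
  have hsq : ‖∑ i, a i • y i‖ ^ 2 ≤ D ^ 2 := by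
    refine le_trans ?_ hle
    rw [← real_inner_self_eq_norm_sq, sum_inner, sq (∑ i, a i), Finset.sum_mul_sum,
      Finset.mul_sum, Finset.mul_sum, ← Finset.sum_add_distrib]
    refine Finset.sum_le_sum fun i _ => ?_
    rw [inner_sum, ← Finset.add_sum_erase _ _ (Finset.mem_univ i),
      ← Finset.add_sum_erase _ (fun j => a i * a j) (Finset.mem_univ i), mul_add, Finset.mul_sum]
    have hii : ⟪a i • y i, a i • y i⟫ = a i ^ 2 := by
      rw [real_inner_self_eq_norm_sq, norm_smul, hy, mul_one, Real.norm_eq_abs, sq_abs]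
    have hij : ∑ j ∈ Finset.univ.erase i, ⟪a i • y i, a j • y j⟫ ≤
        ∑ j ∈ Finset.univ.erase i, 1 / 2 * (a i * a j) := by
      refine Finset.sum_le_sum fun j hj => ?_
      rw [real_inner_smul_left, real_inner_smul_right, ← mul_assoc, mul_comm]
      exact mul_le_mul_of_nonneg_right (hsep i j (Finset.ne_of_mem_erase hj).symm)
        (mul_nonneg (ha i) (ha j))
    linarith
  calc ∑ i, a i * ⟪e, y i⟫ = ⟪e, ∑ i, a i • y i⟫ := by simp [inner_sum, real_inner_smul_right]
    _ ≤ ‖e‖ * ‖∑ i, a i • y i‖ := real_inner_le_norm _ _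
    _ ≤ D := by rw [he, one_mul]; exact le_of_sq_le_sq hsq hD

/-- The index of the affine piece that bounds the test function at `-u`. -/
noncomputable def pieceIndex (u : ℝ) : Fin 3 :=
  if u ≤ 17 / 25 then 0 else if u ≤ 4 / 5 then 1 else 2

noncomputable def pieceSlope : Fin 3 → ℝ := ![321/250, 1357/250, 3071/250]

noncomputable def pieceOffset : Fin 3 → ℝ := ![7447/10000, 35627/10000, 3619/400]

theorem testFunction_neg_le_piece {u : ℝ} (hu : 29 / 50 ≤ u) (hu1 : u ≤ 1) :
    testFunction (-u) ≤ pieceSlope (pieceIndex u) * u - pieceOffset (pieceIndex u) := by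
  unfold pieceIndex
  split_ifs with h h'
  · have := testFunction_le_low (t := -u) (by linarith) (by linarith)
    simpa [pieceSlope, pieceOffset] using this
  · have := testFunction_le_middle (t := -u) (by linarith) (by linarith)
    simpa [pieceSlope, pieceOffset] using this
  · have := testFunction_le_high (t := -u) (by linarith) (by linarith)
    simpa [pieceSlope, pieceOffset] using this

theorem piece_quadratic_bound {a b c : ℕ} (h : a + b + c ≤ 4) :
    1 / 2 * (a * (321/250 : ℝ) ^ 2 + b * (1357/250) ^ 2 + c * (3071/250) ^ 2) +
      1 / 2 * (a * (321/250) + b * (1357/250) + c * (3071/250)) ^ 2 ≤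
      (811/250 + (a * (7447/10000) + b * (35627/10000) + c * (3619/400))) ^ 2 := by
  have ha : a ≤ 4 := by omega
  have hb : b ≤ 4 := by omega
  have hc : c ≤ 4 := by omega
  interval_cases a <;> interval_cases b <;> interval_cases c <;>
    first | (exfalso; omega) | norm_num

theorem sum_testFunction_cap_le {ι : Type*} [Fintype ι] {e : EuclideanSpace ℝ (Fin 3)}
    {y : ι → EuclideanSpace ℝ (Fin 3)} (he : ‖e‖ = 1) (hy : ∀ i, ‖y i‖ = 1)
    (hsep : ∀ i j, i ≠ j → ⟪y i, y j⟫ ≤ 1 / 2) (hcap : ∀ i, 29 / 50 ≤ ⟪e, y i⟫) :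
    ∑ i, testFunction (-⟪e, y i⟫) ≤ 811/250 := by
  let k (i : ι) : Fin 3 := pieceIndex ⟪e, y i⟫
  let n (p : Fin 3) : ℕ := (Finset.univ.filter fun i => k i = p).card
  have hfiber (h : Fin 3 → ℝ) : ∑ i, h (k i) = n 0 * h 0 + n 1 * h 1 + n 2 * h 2 := by
    rw [← Finset.sum_fiberwise (s := Finset.univ) (g := k) (f := fun i => h (k i)),
      Fin.sum_univ_three]
    have hp (p : Fin 3) : ∑ i with k i = p, h (k i) = n p * h p := by
      rw [Finset.sum_congr rfl fun i hi => by rw [(Finset.mem_filter.1 hi).2],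
        Finset.sum_const, nsmul_eq_mul]
    rw [hp, hp, hp]
  have hn : n 0 + n 1 + n 2 ≤ 4 := by
    have h := hfiber fun _ => 1
    simp only [Finset.sum_const, Finset.card_univ, nsmul_eq_mul, mul_one] at h
    have hc := card_cap_le_four he hy hsep hcap
    exact_mod_cast h ▸ (Nat.cast_le (α := ℝ)).2 hc
  have hslope (p : Fin 3) : 0 ≤ pieceSlope p := by
    fin_cases p <;> norm_num [pieceSlope]
  have hoffset (p : Fin 3) : 0 ≤ pieceOffset p := by
    fin_cases p <;> norm_num [pieceOffset]
  have hD : 0 ≤ 811/250 + ∑ i, pieceOffset (k i) := by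
    have := Finset.sum_nonneg fun i (_ : i ∈ Finset.univ) => hoffset (k i)
    positivity
  have hlinear := sum_mul_inner_le he hy hsep (a := fun i => pieceSlope (k i))
    (fun i => hslope _) (D := 811/250 + ∑ i, pieceOffset (k i)) hD (by
      rw [hfiber (fun p => pieceSlope p ^ 2), hfiber pieceSlope, hfiber pieceOffset]
      exact piece_quadratic_bound hn)
  calc ∑ i, testFunction (-⟪e, y i⟫)
      ≤ ∑ i, (pieceSlope (k i) * ⟪e, y i⟫ - pieceOffset (k i)) :=
        Finset.sum_le_sum fun i _ => testFunction_neg_le_piece (hcap i)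
          (by simpa [he, hy] using real_inner_le_norm e (y i))
    _ ≤ 811/250 := by rw [Finset.sum_sub_distrib]; linarith

/-! ### The kissing number -/

theorem sum_testFunction_le {N : ℕ} {x : Fin N → EuclideanSpace ℝ (Fin 3)}
    (hx : ∀ i, ‖x i‖ = 1) (hsep : ∀ i j, i ≠ j → ⟪x i, x j⟫ ≤ 1 / 2) (i : Fin N) :
    ∑ j, testFunction ⟪x i, x j⟫ ≤ 12999/1000 := by
  let s : Finset (Fin N) := Finset.univ.filter fun j => ⟪x i, x j⟫ ≤ -29/50
  have hone : testFunction ⟪x i, x i⟫ = 1951/200 := by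
    rw [real_inner_self_eq_norm_sq, hx]
    norm_num [testFunction, legendreOne, legendreTwo, legendreThree, legendreFour, legendreNine]
  have hi : i ∉ s := by
    simp only [s, Finset.mem_filter, real_inner_self_eq_norm_sq, hx]
    norm_num
  have hcap : ∑ j ∈ s, testFunction ⟪x i, x j⟫ ≤ 811/250 := by
    have h := sum_testFunction_cap_le (ι := s) (e := -x i) (y := fun j => x j)
      (by rw [norm_neg, hx]) (fun j => hx j) (fun j l hjl => hsep j l (Subtype.coe_ne_coe.2 hjl))
      (fun j => by
        have := (Finset.mem_filter.1 j.2).2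
        rw [inner_neg_left]
        linarith)
    simp only [inner_neg_left, neg_neg] at h
    rwa [Finset.sum_coe_sort s fun j => testFunction ⟪x i, x j⟫] at h
  have hrest : ∑ j ∈ sᶜ.erase i, testFunction ⟪x i, x j⟫ ≤ 0 := by
    refine Finset.sum_nonpos fun j hj => ?_
    obtain ⟨hji, hjs⟩ := Finset.mem_erase.1 hj
    simp only [s, Finset.mem_compl, Finset.mem_filter, Finset.mem_univ, true_and, not_le] at hjs
    exact testFunction_nonpos hjs.le (hsep i j hji.symm)
  rw [← Finset.sum_add_sum_compl s, ← Finset.add_sum_erase _ _ (Finset.mem_compl.2 hi), hone]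
  linarith

theorem sq_le_sum_testFunction {N : ℕ} {x : Fin N → EuclideanSpace ℝ (Fin 3)}
    (hx : ∀ i, ‖x i‖ = 1) : (N : ℝ) ^ 2 ≤ ∑ i, ∑ j, testFunction ⟪x i, x j⟫ := by
  simp only [testFunction, Finset.sum_add_distrib, ← Finset.mul_sum]
  have h : ∑ _i : Fin N, ∑ _j : Fin N, (1 : ℝ) = (N : ℝ) ^ 2 := by simp [sq]
  rw [h]
  linarith [sum_legendre_one_nonneg hx, sum_legendre_two_nonneg hx, sum_legendre_three_nonneg hx,
    sum_legendre_four_nonneg hx, sum_legendre_nine_nonneg hx]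

/-- The kissing number in dimension 3 is at most 12. -/
theorem kissing_dim3_le (N : ℕ)
    (x : Fin N → EuclideanSpace ℝ (Fin 3))
    (hx : ∀ i, ‖x i‖ = 1)
    (hsep : ∀ i j, i ≠ j → ⟪x i, x j⟫ ≤ 1 / 2) :
    N ≤ 12 := by
  have hlower := sq_le_sum_testFunction hx
  have hupper := Finset.sum_le_sum fun i (_ : i ∈ Finset.univ) => sum_testFunction_le hx hsep i
  rw [Finset.sum_const, Finset.card_univ, Fintype.card_fin, nsmul_eq_mul] at hupper
  by_contra! hN
  have hN' : (13 : ℝ) ≤ N := by exact_mod_cast hN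
  nlinarith
end

section
/- The kissing number in dimension 4 is at most 24: every finite set of unit vectors x_1, …, x_N in ℝ^{4} satisfying ⟨x_i, x_j⟩ ≤ 1/2 for all i ≠ j has N ≤ 24. -/
open scoped RealInnerProductSpace BigOperators

namespace KissingDimFour

/-! ### Polynomials with integer coefficients as nested lists -/

section ListPolynomial

variable {α R : Type*}

/-- Horner evaluation at `x` of a list of coefficients, interpreted by `φ`. -/
def evalWith [CommSemiring R] (φ : α → R) (x : R) : List α → R
  | [] => 0
  | a :: l => φ a + x * evalWith φ x l

/-- Coefficientwise addition. -/
def addWith (add : α → α → α) : List α → List α → List α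
  | [], m => m
  | a :: l, [] => a :: l
  | a :: l, b :: m => add a b :: addWith add l m

/-- Convolution of coefficient lists. -/
def mulWith (add mul : α → α → α) (zero : α) : List α → List α → List α
  | [], _ => []
  | a :: l, m => addWith add (m.map (mul a)) (zero :: mulWith add mul zero l m)

section Semiring

variable [CommSemiring R] {φ : α → R} {add mul : α → α → α} {zero : α}

theorem evalWith_map {β : Type*} (f : β → α) (x : R) (l : List β) :
    evalWith φ x (l.map f) = evalWith (fun b => φ (f b)) x l := by
  induction l with
  | nil => rfl
  | cons a l ih => simp [evalWith, ih]

theorem evalWith_const_mul (c x : R) (l : List α) :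
    evalWith (fun a => c * φ a) x l = c * evalWith φ x l := by
  induction l with
  | nil => simp [evalWith]
  | cons a l ih => simp only [evalWith, ih]; ring

theorem evalWith_add (hadd : ∀ a b, φ (add a b) = φ a + φ b) (x : R) (l m : List α) :
    evalWith φ x (addWith add l m) = evalWith φ x l + evalWith φ x m := by
  induction l generalizing m with
  | nil => simp [evalWith, addWith]
  | cons a l ih =>
    cases m with
    | nil => simp [evalWith, addWith]
    | cons b m => simp only [evalWith, addWith, hadd, ih]; ring

theorem evalWith_mul (hadd : ∀ a b, φ (add a b) = φ a + φ b)
    (hmul : ∀ a b, φ (mul a b) = φ a * φ b) (hzero : φ zero = 0) (x : R) (l m : List α) :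
    evalWith φ x (mulWith add mul zero l m) = evalWith φ x l * evalWith φ x m := by
  induction l with
  | nil => simp [evalWith, mulWith]
  | cons a l ih =>
    simp only [evalWith, mulWith, evalWith_add hadd, evalWith_map, hmul, evalWith_const_mul,
      hzero, ih]
    ring

end Semiring

section Nat

variable {ψ : α → ℕ} {add mul : α → α → α} {zero : α}

theorem evalWith_mono {ψ' : α → ℕ} (h : ∀ a, ψ a ≤ ψ' a) {x x' : ℕ} (hx : x ≤ x') (l : List α) :
    evalWith ψ x l ≤ evalWith ψ' x' l := by
  induction l with
  | nil => rfl
  | cons a l ih => exact add_le_add (h a) (Nat.mul_le_mul hx ih)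

theorem evalWith_add_le (hadd : ∀ a b, ψ (add a b) ≤ ψ a + ψ b) (x : ℕ) (l m : List α) :
    evalWith ψ x (addWith add l m) ≤ evalWith ψ x l + evalWith ψ x m := by
  induction l generalizing m with
  | nil => simp [evalWith, addWith]
  | cons a l ih =>
    cases m with
    | nil => simp [evalWith, addWith]
    | cons b m =>
      simp only [evalWith, addWith]
      linarith [hadd a b, Nat.mul_le_mul_left x (ih m)]

theorem evalWith_mul_le (hadd : ∀ a b, ψ (add a b) ≤ ψ a + ψ b)
    (hmul : ∀ a b, ψ (mul a b) ≤ ψ a * ψ b) (hzero : ψ zero = 0) (x : ℕ) (l m : List α) :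
    evalWith ψ x (mulWith add mul zero l m) ≤ evalWith ψ x l * evalWith ψ x m := by
  induction l with
  | nil => simp [evalWith, mulWith]
  | cons a l ih =>
    have h₁ : evalWith ψ x (m.map (mul a)) ≤ ψ a * evalWith ψ x m := by
      rw [evalWith_map, ← evalWith_const_mul]
      exact evalWith_mono (hmul a) le_rfl m
    refine (evalWith_add_le hadd x _ _).trans ?_
    simp only [evalWith, hzero, zero_add, add_mul, mul_assoc]
    exact add_le_add h₁ (Nat.mul_le_mul_left x ih)

theorem le_evalWith_one {a : α} {l : List α} (h : a ∈ l) : ψ a ≤ evalWith ψ 1 l := by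
  induction l with
  | nil => simp at h
  | cons b l ih =>
    simp only [evalWith, one_mul]
    rcases List.mem_cons.1 h with rfl | h
    · omega
    · have := ih h
      omega

end Nat

theorem abs_evalWith_le [CommRing R] [LinearOrder R] [IsStrictOrderedRing R] {φ : α → R}
    {ψ : α → ℕ} (h : ∀ a, |φ a| ≤ ψ a) {x : R} {X : ℕ} (hx : |x| ≤ X) (l : List α) :
    |evalWith φ x l| ≤ (evalWith ψ X l : ℕ) := by
  induction l with
  | nil => simp [evalWith]
  | cons a l ih =>
    simp only [evalWith, Nat.cast_add, Nat.cast_mul]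
    refine (abs_add_le _ _).trans (add_le_add (h a) ?_)
    rw [abs_mul]
    exact mul_le_mul hx ih (abs_nonneg _) (Nat.cast_nonneg _)

/-- An integer polynomial with small coefficients that vanishes at a large integer is zero. -/
theorem eq_zero_of_evalWith_eq_zero {φ : α → ℤ} {B : ℕ} {l : List α}
    (hB : ∀ a ∈ l, |φ a| < B) (h : evalWith φ B l = 0) : ∀ a ∈ l, φ a = 0 := by
  induction l with
  | nil => simp
  | cons b l ih =>
    have hb := hB b List.mem_cons_self
    simp only [evalWith] at h
    have hφ : φ b = 0 :=
      Int.eq_zero_of_abs_lt_dvd (m := B) ⟨-evalWith φ B l, by linear_combination h⟩ hb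
    have hBpos : (B : ℤ) ≠ 0 := ((abs_nonneg _).trans_lt hb).ne'
    have hl : evalWith φ B l = 0 := by
      rw [hφ, zero_add] at h
      exact (mul_eq_zero.1 h).resolve_left hBpos
    intro a ha
    rcases List.mem_cons.1 ha with rfl | ha
    · exact hφ
    · exact ih (fun a ha => hB a (List.mem_cons_of_mem _ ha)) hl a ha

theorem evalWith_eq_zero [CommSemiring R] {φ : α → R} (x : R) {l : List α}
    (h : ∀ a ∈ l, φ a = 0) : evalWith φ x l = 0 := by
  induction l with
  | nil => rfl
  | cons b l ih =>
    simp [evalWith, h b List.mem_cons_self, ih fun a ha => h a (List.mem_cons_of_mem _ ha)]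

end ListPolynomial

/-- Integer polynomials in one variable. -/
abbrev Poly₁ := List ℤ

/-- Integer polynomials in two variables, the first one outermost. -/
abbrev Poly₂ := List Poly₁

/-- Integer polynomials in three variables, the first one outermost. -/
abbrev Poly₃ := List Poly₂

/-- Sum of polynomials in one variable. -/
def add₁ : Poly₁ → Poly₁ → Poly₁ := addWith (· + ·)

/-- Sum of polynomials in two variables. -/
def add₂ : Poly₂ → Poly₂ → Poly₂ := addWith add₁

/-- Sum of polynomials in three variables. -/
def add₃ : Poly₃ → Poly₃ → Poly₃ := addWith add₂

/-- Product of polynomials in one variable. -/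
def mul₁ : Poly₁ → Poly₁ → Poly₁ := mulWith (· + ·) (· * ·) 0

/-- Product of polynomials in two variables. -/
def mul₂ : Poly₂ → Poly₂ → Poly₂ := mulWith add₁ mul₁ []

/-- Product of polynomials in three variables. -/
def mul₃ : Poly₃ → Poly₃ → Poly₃ := mulWith add₂ mul₂ []

section Eval

variable {R : Type*} [CommRing R]

/-- Evaluation at a point. -/
def eval₁ (x : R) : Poly₁ → R := evalWith Int.cast x

/-- Evaluation at a point. -/
def eval₂ (x y : R) : Poly₂ → R := evalWith (eval₁ y) x

/-- Evaluation at a point. -/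
def eval₃ (x y z : R) : Poly₃ → R := evalWith (eval₂ y z) x

variable (x y z : R)

theorem eval₁_add (p q : Poly₁) : eval₁ x (add₁ p q) = eval₁ x p + eval₁ x q :=
  evalWith_add Int.cast_add x p q

theorem eval₁_mul (p q : Poly₁) : eval₁ x (mul₁ p q) = eval₁ x p * eval₁ x q :=
  evalWith_mul Int.cast_add Int.cast_mul Int.cast_zero x p q

theorem eval₂_add (p q : Poly₂) : eval₂ x y (add₂ p q) = eval₂ x y p + eval₂ x y q :=
  evalWith_add (eval₁_add y) x p q

theorem eval₂_mul (p q : Poly₂) : eval₂ x y (mul₂ p q) = eval₂ x y p * eval₂ x y q :=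
  evalWith_mul (eval₁_add y) (eval₁_mul y) rfl x p q

theorem eval₃_add (p q : Poly₃) : eval₃ x y z (add₃ p q) = eval₃ x y z p + eval₃ x y z q :=
  evalWith_add (eval₂_add y z) x p q

theorem eval₃_mul (p q : Poly₃) : eval₃ x y z (mul₃ p q) = eval₃ x y z p * eval₃ x y z q :=
  evalWith_mul (eval₂_add y z) (eval₂_mul y z) rfl x p q

theorem eval₃_const (c : ℤ) : eval₃ x y z [[[c]]] = c := by
  simp [eval₃, eval₂, eval₁, evalWith]

theorem cast_eval₃ (a b c : ℤ) (p : Poly₃) :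
    ((eval₃ a b c p : ℤ) : R) = eval₃ (a : R) (b : R) (c : R) p := by
  have key {α : Type} (φ : α → ℤ) (φ' : α → R) (h : ∀ p, (φ p : R) = φ' p) (a : ℤ) (l : List α) :
      ((evalWith φ a l : ℤ) : R) = evalWith φ' (a : R) l := by
    induction l with
    | nil => simp [evalWith]
    | cons p l ih => simp [evalWith, ih, h]
  exact key _ _ (key _ _ (key _ _ (by simp) c) b) a p

end Eval

/-- Evaluation of the polynomial whose coefficients are replaced by their absolute values. -/
def abs₁ (x : ℕ) : Poly₁ → ℕ := evalWith Int.natAbs x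

/-- Evaluation of the polynomial whose coefficients are replaced by their absolute values. -/
def abs₂ (x y : ℕ) : Poly₂ → ℕ := evalWith (abs₁ y) x

/-- Evaluation of the polynomial whose coefficients are replaced by their absolute values. -/
def abs₃ (x y z : ℕ) : Poly₃ → ℕ := evalWith (abs₂ y z) x

theorem abs₃_add_le (x y z : ℕ) (p q : Poly₃) :
    abs₃ x y z (add₃ p q) ≤ abs₃ x y z p + abs₃ x y z q :=
  evalWith_add_le (evalWith_add_le (evalWith_add_le Int.natAbs_add_le z) y) x p q

theorem abs₃_mul_le (x y z : ℕ) (p q : Poly₃) :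
    abs₃ x y z (mul₃ p q) ≤ abs₃ x y z p * abs₃ x y z q :=
  evalWith_mul_le (evalWith_add_le (evalWith_add_le Int.natAbs_add_le z) y)
    (evalWith_mul_le (evalWith_add_le Int.natAbs_add_le z)
      (evalWith_mul_le Int.natAbs_add_le (fun a b => (Int.natAbs_mul a b).le) rfl z) rfl y)
    rfl x p q

section AbsEval

variable {R : Type*} [CommRing R] [LinearOrder R] [IsStrictOrderedRing R]

theorem abs_eval₁_le {x : R} {X : ℕ} (hx : |x| ≤ X) (p : Poly₁) :
    |eval₁ x p| ≤ (abs₁ X p : ℕ) :=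
  abs_evalWith_le (fun a => by rw [Nat.cast_natAbs, Int.cast_abs]) hx p

theorem abs_eval₂_le {x y : R} {X Y : ℕ} (hx : |x| ≤ X) (hy : |y| ≤ Y) (p : Poly₂) :
    |eval₂ x y p| ≤ (abs₂ X Y p : ℕ) :=
  abs_evalWith_le (abs_eval₁_le hy) hx p

theorem abs_eval₃_le {x y z : R} {X Y Z : ℕ} (hx : |x| ≤ X) (hy : |y| ≤ Y) (hz : |z| ≤ Z)
    (p : Poly₃) : |eval₃ x y z p| ≤ (abs₃ X Y Z p : ℕ) :=
  abs_evalWith_le (abs_eval₂_le hy hz) hx p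

end AbsEval

/-- Vanishing of a polynomial with small coefficients can be tested at one integer point. -/
theorem eval₃_eq_zero_of_kronecker {p : Poly₃} {A B C : ℕ}
    (hC : abs₃ 1 1 1 p < C) (hB : abs₃ 1 1 C p < B) (hA : abs₃ 1 B C p < A)
    (h : eval₃ (A : ℤ) B C p = 0) (x y z : ℝ) : eval₃ x y z p = 0 := by
  have habs (n : ℕ) : |(n : ℤ)| ≤ (n : ℕ) := by simp
  have h₂ : ∀ q ∈ p, eval₂ (B : ℤ) C q = 0 :=
    eq_zero_of_evalWith_eq_zero (fun q hq => by
      have := le_evalWith_one (ψ := abs₂ B C) hq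
      refine (abs_eval₂_le (habs B) (habs C) q).trans_lt ?_
      exact_mod_cast this.trans_lt hA) h
  refine evalWith_eq_zero x fun q hq => evalWith_eq_zero y fun r hr => evalWith_eq_zero z ?_
  have h₁ : ∀ r ∈ q, eval₁ (C : ℤ) r = 0 :=
    eq_zero_of_evalWith_eq_zero (fun r hr => by
      have h₁ := le_evalWith_one (ψ := abs₁ C) hr
      have h₂ := le_evalWith_one (ψ := abs₂ 1 C) hq
      refine (abs_eval₁_le (habs C) r).trans_lt ?_
      exact_mod_cast (h₁.trans h₂).trans_lt hB) (h₂ q hq)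
  have h₀ : ∀ c ∈ r, (Int.cast c : ℤ) = 0 :=
    eq_zero_of_evalWith_eq_zero (fun c hc => by
      have h₀ := le_evalWith_one (ψ := Int.natAbs) hc
      have h₁ := le_evalWith_one (ψ := abs₁ 1) hr
      have h₂ := le_evalWith_one (ψ := abs₂ 1 1) hq
      rw [Int.cast_id, Int.abs_eq_natAbs]
      exact_mod_cast ((h₀.trans h₁).trans h₂).trans_lt hC) (h₁ r hr)
  intro c hc
  simpa using h₀ c hc

/-! ### Operations on polynomials -/

/-- Horner substitution of a polynomial `x` for the outermost variable. -/
def substWith {α : Type} (φ : α → Poly₃) (x : Poly₃) : List α → Poly₃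
  | [] => []
  | a :: l => add₃ (φ a) (mul₃ x (substWith φ x l))

/-- Substitution of a polynomial for the variable. -/
def subst₁ (x : Poly₃) : Poly₁ → Poly₃ := substWith (fun c => [[[c]]]) x

/-- Substitution of polynomials for both variables. -/
def subst₂ (x y : Poly₃) : Poly₂ → Poly₃ := substWith (subst₁ y) x

/-- Substitution of polynomials for all variables. -/
def subst₃ (x y z : Poly₃) : Poly₃ → Poly₃ := substWith (subst₂ y z) x

/-- Exchange of the two variables. -/
def swap₂ : Poly₂ → Poly₂
  | [] => []
  | p :: l => add₂ (p.map fun c => [c]) ((swap₂ l).map fun q => 0 :: q)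

/-- Exchange of the two outer variables. -/
def swapOuter : Poly₃ → Poly₃
  | [] => []
  | p :: l => add₃ (p.map fun q => [q]) ((swapOuter l).map fun q => [] :: q)

/-- The polynomial `p (t, u, v)`. -/
def rotate (p : Poly₃) : Poly₃ := (swapOuter p).map swap₂

/-- Sum over the cyclic permutations of the variables. -/
def cyclicSum (p : Poly₃) : Poly₃ := add₃ p (add₃ (rotate p) (rotate (rotate p)))

/-- Sum of squares. -/
def sumSq : List Poly₃ → Poly₃
  | [] => []
  | q :: l => add₃ (mul₃ q q) (sumSq l)

section

variable (x y z : ℝ)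

theorem eval₃_substWith {α : Type} {φ : α → Poly₃} {ψ : α → ℝ}
    (h : ∀ a, eval₃ x y z (φ a) = ψ a) (p : Poly₃) (l : List α) :
    eval₃ x y z (substWith φ p l) = evalWith ψ (eval₃ x y z p) l := by
  induction l with
  | nil => rfl
  | cons a l ih => simp only [substWith, eval₃_add, eval₃_mul, h, ih, evalWith]

theorem eval₃_subst₁ (a : Poly₃) (p : Poly₁) :
    eval₃ x y z (subst₁ a p) = eval₁ (eval₃ x y z a) p :=
  eval₃_substWith x y z (eval₃_const x y z) a p

theorem eval₃_subst₂ (a b : Poly₃) (p : Poly₂) :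
    eval₃ x y z (subst₂ a b p) = eval₂ (eval₃ x y z a) (eval₃ x y z b) p :=
  eval₃_substWith x y z (eval₃_subst₁ x y z b) a p

theorem eval₃_subst₃ (a b c : Poly₃) (p : Poly₃) :
    eval₃ x y z (subst₃ a b c p) = eval₃ (eval₃ x y z a) (eval₃ x y z b) (eval₃ x y z c) p :=
  eval₃_substWith x y z (eval₃_subst₂ x y z b c) a p

theorem eval₂_swap₂ (p : Poly₂) : eval₂ x y (swap₂ p) = eval₂ y x p := by
  induction p with
  | nil => rfl
  | cons a p ih =>
    simp only [eval₂] at ih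
    simp only [swap₂, eval₂_add]
    simp only [eval₂, evalWith, evalWith_map, eval₁, mul_zero, add_zero, Int.cast_zero, zero_add,
      evalWith_const_mul]
    simp only [eval₁] at ih
    rw [ih]

theorem eval₃_swapOuter (p : Poly₃) : eval₃ x y z (swapOuter p) = eval₃ y x z p := by
  induction p with
  | nil => rfl
  | cons a p ih =>
    have h₀ : eval₁ z [] = 0 := rfl
    simp only [eval₃] at ih
    simp only [swapOuter, eval₃_add]
    simp only [eval₃, evalWith, evalWith_map, eval₂, mul_zero, add_zero, h₀, zero_add,
      evalWith_const_mul]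
    simp only [eval₂] at ih
    rw [ih]

theorem eval₃_rotate (p : Poly₃) : eval₃ x y z (rotate p) = eval₃ z x y p := by
  rw [← eval₃_swapOuter x z y p, rotate, eval₃, eval₃, evalWith_map]
  simp only [eval₂_swap₂]

theorem eval₃_cyclicSum (p : Poly₃) :
    eval₃ x y z (cyclicSum p) = eval₃ x y z p + (eval₃ z x y p + eval₃ y z x p) := by
  simp only [cyclicSum, eval₃_add, eval₃_rotate]

theorem eval₃_sumSq {R : Type*} [CommRing R] (x y z : R) (l : List Poly₃) :
    eval₃ x y z (sumSq l) = (l.map fun q => eval₃ x y z q ^ 2).sum := by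
  induction l with
  | nil => rfl
  | cons q l ih => simp [sumSq, eval₃_add, eval₃_mul, ih, sq]

theorem eval₃_sumSq_nonneg (l : List Poly₃) : 0 ≤ eval₃ x y z (sumSq l) := by
  rw [eval₃_sumSq]
  exact List.sum_nonneg fun a ha => by
    obtain ⟨q, -, rfl⟩ := List.mem_map.1 ha
    positivity

end

theorem abs₃_sumSq_le (x y z : ℕ) (l : List Poly₃) :
    abs₃ x y z (sumSq l) ≤ (l.map fun q => abs₃ x y z q ^ 2).sum := by
  induction l with
  | nil => rfl
  | cons q l ih =>
    simp only [sumSq, List.map_cons, List.sum_cons, sq]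
    simp only [sq] at ih
    exact (abs₃_add_le x y z _ _).trans (add_le_add (abs₃_mul_le x y z q q) ih)

/-! ### Sums of squares by Kronecker substitution -/

/-- The base of the Kronecker substitution. -/
def base : ℕ := 2 ^ 96

/-- At most `k` signed base `B` digits of `n`. -/
def signedDigits (B : ℕ) : ℕ → ℤ → List ℤ
  | 0, _ => []
  | k + 1, n =>
    if n = 0 then [] else n.bmod B :: signedDigits B k ((n - n.bmod B) / B)

/-- The value of `∑ q ^ 2` at the point of the Kronecker substitution. -/
def sumSqValue (l : List Poly₃) : ℤ :=
  (l.map fun q => eval₃ ((base ^ 120 : ℕ) : ℤ) ((base ^ 8 : ℕ) : ℤ) (base : ℤ) q ^ 2).sum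

/-- `∑ q ^ 2` for a list of polynomials of small degree with small coefficients. -/
def fastSumSq (l : List Poly₃) : Poly₃ :=
  (signedDigits (base ^ 120) 15 (sumSqValue l)).map fun a =>
    (signedDigits (base ^ 8) 15 a).map (signedDigits base 8)

/-- Bound on the coefficients of `∑ q ^ 2 - p`. -/
def differenceBound (l : List Poly₃) (p : Poly₃) (x y z : ℕ) : ℕ :=
  (l.map fun q => abs₃ x y z q ^ 2).sum + abs₃ x y z p

/-- A numerical test for `p = ∑ q ^ 2`. -/
def IsSumSq (l : List Poly₃) (p : Poly₃) : Prop :=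
  differenceBound l p 1 1 1 < base ∧ differenceBound l p 1 1 base < base ^ 8 ∧
    differenceBound l p 1 (base ^ 8) base < base ^ 120 ∧
      sumSqValue l = eval₃ ((base ^ 120 : ℕ) : ℤ) ((base ^ 8 : ℕ) : ℤ) (base : ℤ) p

instance (l : List Poly₃) (p : Poly₃) : Decidable (IsSumSq l p) :=
  inferInstanceAs (Decidable (_ ∧ _ ∧ _ ∧ _))

theorem eval₃_nonneg_of_isSumSq {l : List Poly₃} {p : Poly₃} (h : IsSumSq l p) (x y z : ℝ) :
    0 ≤ eval₃ x y z p := by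
  obtain ⟨hC, hB, hA, hval⟩ := h
  have hbound (x y z : ℕ) :
      abs₃ x y z (add₃ (sumSq l) (mul₃ [[[-1]]] p)) ≤ differenceBound l p x y z := by
    refine (abs₃_add_le x y z _ _).trans
      (add_le_add (abs₃_sumSq_le x y z l) ((abs₃_mul_le x y z _ _).trans_eq ?_))
    simp [abs₃, abs₂, abs₁, evalWith]
  have hzero := eval₃_eq_zero_of_kronecker ((hbound _ _ _).trans_lt hC) ((hbound _ _ _).trans_lt hB)
    ((hbound _ _ _).trans_lt hA) (by
      rw [eval₃_add, eval₃_mul, eval₃_const, eval₃_sumSq, ← sumSqValue, hval]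
      simp) x y z
  rw [eval₃_add, eval₃_mul, eval₃_const] at hzero
  have := eval₃_sumSq_nonneg x y z l
  push_cast at hzero
  linarith

/-! ### The kernel and its certificates -/

/-- The first variable. -/
def varU : Poly₃ := [[], [[1]]]

/-- The second variable. -/
def varV : Poly₃ := [[[], [1]]]

/-- The third variable. -/
def varT : Poly₃ := [[[0, 1]]]

/-- The constant polynomial `1`. -/
def one₃ : Poly₃ := [[[1]]]

/-- `8 * P_k(s / √r) * √r ^ k` for the Legendre polynomial `P_k` with `k = 0`, as a polynomial
in `s` and `r`. -/
def legendre₀ : Poly₂ := [[8]]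

/-- See `legendre₀`. -/
def legendre₁ : Poly₂ := [[], [8]]

/-- See `legendre₀`. -/
def legendre₂ : Poly₂ := [[0, -4], [], [12]]

/-- See `legendre₀`. -/
def legendre₃ : Poly₂ := [[], [0, -12], [], [20]]

/-- See `legendre₀`. -/
def legendre₄ : Poly₂ := [[0, 0, 3], [], [0, -30], [], [35]]

/-- See `legendre₀`. -/
def legendre₅ : Poly₂ := [[], [0, 0, 15], [], [0, -70], [], [63]]

/-- The kernel `L(u - v t, (1 - v²)(1 - t²))`. -/
def zonal (L : Poly₂) : Poly₃ :=
  subst₂ [[[0], [0, -1]], [[1]]] [[[1, 0, -1], [], [-1, 0, 1]]] L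

/-- The kernel `∑ p(v) p(t)` over a list of univariate polynomials. -/
def tensorSum : List Poly₁ → Poly₃
  | [] => []
  | p :: l => add₃ [p.map fun c => p.map (c * ·)] (tensorSum l)

/-- The kernel `L(u - v t, (1 - v²)(1 - t²)) ∑ p(v) p(t)`. -/
def kernelTerm (L : Poly₂) (ps : List Poly₁) : Poly₃ := mul₃ (zonal L) (tensorSum ps)

/-- The base `2 ^ 32` digits of `n`, shifted by `2 ^ 31`, at most `k` of them. -/
def shiftedDigits : ℕ → ℕ → List ℤ
  | 0, _ => []
  | _ + 1, 0 => []
  | k + 1, n + 1 =>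
    (((n + 1) % 4294967296 : ℕ) - 2147483648 : ℤ) :: shiftedDigits k ((n + 1) / 4294967296)

/-- Cut a list into pieces of prescribed lengths. -/
def cut {α : Type} : List ℕ → List α → List (List α)
  | [], _ => []
  | _ :: _, [] => []
  | n :: ns, a :: l => (a :: l).take n :: cut ns ((a :: l).drop n)

/-- The polynomial of degree at most `d`, where the variables have weights 1, 1, 2, with the
coefficients given by the signed digits of `n`. -/
def decode (d n : ℕ) : Poly₃ :=
  cut ((List.range (d + 1)).map fun a => d + 1 - a)
    (cut ((List.range (d + 1)).flatMap fun a =>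
      (List.range (d + 1 - a)).map fun b => (d - a - b) / 2 + 1) (shiftedDigits 100 n))

/-- Polynomials weighting the Legendre kernel of degree 0. -/
def factor₀ : List Poly₁ :=
  [[-11565622, -18594242, 45033592, 63139625, -79010237, -185179453, 100318293, 192598841], [-74604,
  36331355, 15451327, -44107810, -67627797, -39884417, 54419354], [-1541234, 34281171, -11602242,
  -80886361, 35167075, 78535533], [2973305, -22825620, -82144099, 70618883, 140331571], [1598833,
  -17773564, -6435016, 26400029], [-3222719, -91457, 12892081], [-2867, 3111901], [48751]]

/-- Polynomials weighting the Legendre kernel of degree 1. -/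
def factor₁ : List Poly₁ :=
  [[-7441731, 36024878, -8643253, -175901214, -66215128, 481401508, 439745105], [5707442, 4957760,
  -80661641, -16170033, 400125627, 345190094], [-10636469, -14676400, -120082207, 48502016,
  182258855], [-10760279, -71303360, 9051452, 103149652], [-2186979, 4230209, 7562721], [-2834,
  4403855], [2862539]]

/-- Polynomials weighting the Legendre kernel of degree 2. -/
def factor₂ : List Poly₁ :=
  [[15122370, -14989543, -65244396, -53584741, 319488941, 352034213], [-12807198, -42678971,
  8532568, 196063685, 187053822], [8402015, -1081027, 80557910, 69935552], [-16839836, 21120155,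
  44767220], [4343182, 3603003], [5627620]]

/-- Polynomials weighting the Legendre kernel of degree 3. -/
def factor₃ : List Poly₁ :=
  [[5281902, -6941250, -74651918, 129551374, 211850272], [-32748542, -79175335, -32966402,
  89890716], [3514072, -532271, 6777678], [-2354797, 5217845], [2964879]]

/-- Polynomials weighting the Legendre kernel of degree 4. -/
def factor₄ : List Poly₁ :=
  [[-4306633, 5735, 1284113, 21657487], [12972693, 23433015, 2088125], [13118004, 28176275],
  [2708623]]

/-- Polynomials weighting the Legendre kernel of degree 5. -/
def factor₅ : List Poly₁ :=
  [[-17053234, -23712366, 40750428], [275391, 889176], [811354]]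

/-- Polynomials in `u`, `v + t`, `v t`. -/
def tripleSq : List Poly₃ := List.map (decode 7) [
  113950445586436779957982422349739422276374723730729859929355380662600125497048167126354643925827573308283264181989517886864220279199865254196748790463791578821071711950743037103926200107734999378833796524060730853817784409173930322312456561284005547728381212300791152319789455859254227208910488666732474799266459469389184526510852643062082127390605045802193890337034758259132063593015329328905204894014635205019018073530367591342118649397673320875860366368338926140827454319392509674914986091572821845962212308650710237667005918334636418016425767307721496146906046814012425229155651980792824953545458563459054582600663443918032184997010016915330160161940225126261804345054203,
  26368381160839724455017150606059424613351461361848677557060317609512792161822306868373621959984615986363091727210440791567153071420290904938352136260144220007661724238113259142553266168774650001553900217678743191896502387112048889583732111057611355514695041766070678150636645460056588505940379371000619871050523642927590966481929860907556568880130678037017664752484559774367571720853411592398084277684956727872890420353794370206742002121182679509985112211999799751421403292413318396070537642748981815351504376335921706060974989336306044918874211219337259062896471686039997985087932663530318536906608921394050890726298731644111464760926416867552363285266871687918103,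
  5765515406065759836298668907463410045342612608574749528788490736143095751019423188837560937518692830830037565270165053265885233914447873059924129468977337858228681186163966703012124670357011197482432014447360626683932372340314645346968698270149717705283482234437916088971836030925561600851593304274110353781857082562746075519446706594900623136993328092105165912642263515994696247632283126600786521143702277104948477759118379239864563278211633798536511744723700153536843325334833568818594691373738116291059058266186887616726596214905281588714040133212608533661312306513948534670104116544882460467207322025536510833787405549212530811983242148241346246694446,
  1430023574489251911408917241570731857556696074535621344646444987201991783480825945239355796877835383266479489707447560362524523395395241249233323025753434609222687221756883104039709907029317720678426502959421368910701160386197569186602432045023864469383882497591163950622067363251058059553998882274389784712074692349055802070762606802368107313515950561263301267098981276257679126734655806374588398077430305853820291395190090660437689750594164044582997385689443517703382217758397003833085410320848345200064814929245784164264000902855184250308282725439704093217482840847053438449517339390039602818917028756093798457023911155581990610530619421823976,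
  313364720219159760444044836662763026462375854790120036377503564851356273758647314756652172871208490830451060224756377475603086815878881600302151938907096477890006602458601561061790652404680051377207448688442483673907159809507632721618949893621307220149290587706333407708855414533759606824298569838911428441747768728616321089418205743595899299801027870994792316294372110866814778953859179999104340274249562830445619673493541937561526978675020205854897549307936947520714549734176165490622358992116502700782843653443578010161835576520536474572436815790161411042027690213404850809601483065659486398735671293201382527338727012309528016396767,
  77951198591558811687349295087711486927821232421264320124069049868556935248397205225374481385941696500292709777154442948650273992633209013353566189999266790417380598509228285832950846507492630355052535465395125510211202042384491540541751573507480898596613831663710948594251157340976460753284432928486718073746795843275411176886996974220852213519583215244782473884959706926034222934319923550359331169832694030306560645187660017204431982972259231937731249487139471527318314517202241491702095441604912698046408653104814983110836104206967464033924040617864206459456985011593803272637212903822961774838731556074224383444492697376573,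
  16514746455998517497596793583395900027377400809963624062175578491945008969926327963608875172380665384241881318970112251173237328443415065825962871333805729545285604716117461675047135110764505878190020898671598760158860783710514451302532668911845269101737627009593732310017688258598601871576041620099912157906146166858633640841961853673063341074290616418583681201491828370203255207231540508134870475958346100580296204762181107059475367510893241330841808340540658605045554710747781331959661238286795055078636554651262195432842354702245821259850921481779879580092196946559154650644617748980669524745163685835862116681721,
  4219228266687271631146710366706546580166404492140391643950644899634329018808745369481088451584462664828182359094294830361437457893746315254976055012575055942871146949703638416270875934122894580370874759790694189678536134280677181633600126261546126394273414959130267511908493462219695152073444604432721732089746077720406176553808371701354679807439615705812130849071837903232402191968790496575886788012283527981713910273881797010053267764834556936388242524063380242763889808402896645423266053881466696275753139298225012949942042971697544876262188870607117999111782531270076014558065618131120636431157509256888,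
  950767081493272150112617737388397306538061441208842105541843463809504290755270761833963044249324754505183384819746189325113455634297376289932395042798228324666804795949369190759943666423879358683591849110598757981952713101896205594566969870212779928869373578504804352690029603658316276767336533369905049110068496365690731352048526399739221082434799721425823456185084526764969549287824859392065911727461187380336564758860805663560838507660285289305548475961093873935948977501719076231575470586262190647793055321990674267045361157625361063197385626483417794881987674900664926732509018886444353001671,
  227565941044117612129527446727332388785075596138417230973696279863328060973020459920018431272484067690955073272342602964547656537501735455064290408746122606314361284245618631423508794991805052528474355965452407385423577853073823149709855161334664517155196365629104548745515950898055865524420314116251035327045235009624941065479529702815653675106846027268030230108806055989524489503787835115740646488392055161168103611145210665352224399423521965122580547913984496739973201542508091759493231922776073532825659255901351801850982767321783273647908535311301447656660293965785904117964552083543,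
  48375892340234478900436352268822711553010975163694161007820170364199295633237847736387915342952659552406059895810060763133021328346398009075492546007621575495123866855558400351771040851723326083142359653774172710532620449669288150524967899064858879718850112805418346120499849300770025616001450757283930287092724828918786244255879931346294584566129032645773065669059453978946863363800421219037231223111979283470548791699278594821720433554319961748127929453882362241922697180374670966160175584440242467631249877546546287125321143307678431425283500162311475042392339987187004523232,
  11468080155034581739273065778362386842883437699779697126051104740520661424716508460534549813571002634728966471388682534107241902202720917626426450458640955704378023801660017968763477398334938025041738088743306556407233070237082152314800289226304368556757711398800843086358862933702802462011654388920612587919080129375955063859959181704913228271580870321310885371319864189278412050383142894397390554316296005262881201888901365668691614658337857991926077746345503147261527574442096504386445583106965191112645802376639579789456539256712794509510834342010370161690275709683,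
  2595776571188417444616768115748668495674218921382368116481911919959741438806602523946025355165836888445000228649708218803237739331724482566382382255701181928858422655118452496796629051198042877362259096679194188251758882893313690314997012722011473598278378231606341970905433279174328094726293351046020023628419229600316911109093314868715035985695260275472069038265137874970245837592703717105463998478508593953892448943490805334296555756986348725537570611284707435182572168030033431610858107773396817124934293757837249942522497890956293319174314048928539276504,
  651034069381977537495167012079375537665832857508200243483872081458734523033767795626465901337733719328410698493943482698973484202188091140794168158674792384032731756462995726373207646138117734647563594253564999453090463726536600375996424385597262349565573024855582193722640967061393140443939553639876804318202619742123794789451855551530314606357117149603452421838230219520829728693462191393136891686339323872443370140935422677963531003756301552362190956383705973128126223266011404859268785209372551523735771735717778411512048545330713814694790951165,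
  149269230909999383125792639478932090181399773148540020980568054565665990760695121226519278508957606007338699355798989246373408619418800355114104700398367721795793289283160411002793425851858087357604559565544643472004654534917401628965541926292994058829063085915566333491391377297671966747691185423795695532443751012740521543829982970185043428074819631239366787541035199014415673137120039805726974071077115230738270410023815998602373016817099554924173529941485614445425397208415962816991449354143824552908973685965178160638049798850710328110,
  35467349180749457449467074321037589933919118628259965190672604366393084364595380829522362840455116188047320221732785497526812572728782013662363112237093103289016416640593972837810797880869048076417056210332960799463988340245392086741908693545890406646018531854991090331667241838902432382869093335969704436139493700924661368514700082179894327846200083901689136231317991031910353074502114728350354196079467097755811696658635813786069301419702331733454349922879536043483047537295539359237783339113547536678093737014816680787887595843,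
  8183972382235927266203475134373843985173235396595757024153920951085015938314067127372660683499078044868272606281189625408032904961046088003140520852378419287109562063849044916980976116411214152346640822762075023106298716948721506909243523904972004876302807432515522249939901418735811118031852729370767193471749985590356150314815599207816321457435323679259720211047287527486204674201658138729623272761180673633520465169348492862414203399003996354794231157062095376937937464738037244149025210418832411805688202393125001652,
  1895178544074392554954260670789985632647594743547616028832743126922858112000674130720537555835046935826217964801162848450866944343039211297441218972182472320408196436642347766659783181267420323635945689395123409051780473473817264394796989749857432974794878314593755887475207548080867906708267239965843074518976848950615031752943711092977053658760520570264301935602878615156931930640684103524070122263731484799194181709322459450412793486308707926184263269549551282667911011281252648411773738581602381460623787419,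
  412888352082515140802476868891807662184145047079633890560464328717371451145718194800193496222797789507932895635838012613703072758572913748066369797502585365019774478844785038291047919908617994592774729664747538701099063048097680047972483794150365207717844368912638913021152491854215240104973296637304503813549981170418726297552400782859757769355454862339079202001961096097655730684368744929729917732581675789617013383577344264917299215541573834690788127094197160787281741870513071855251350584540318529,
  101076250179142536917856924957691401341249280322918311727880918809603837176326263531609773231313784468160795702762170536586346721574864959987038953434803098887245349728361883885631505661517571519528256374924085799333049610481973292482613102436218306248699844218505284481205213043891274099391486399835426043775694872747570411911335045605900633118021413150340928129509659438065498243850535874665567441789374719133153762372976453529090942370500602099877798420472429514810271627316032667449000674,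
  22491367214927747090385172533149782595563692631474044454190358905271990560214155744799910501980522291470602002304444368980767564436132722857692706166171837382278595142178232633037691983716015251394886639924676873021211442215587753198119946531256629730008182434766151249987298535477132735410756731157700157693907889713631056567919449356064495942692456709887603245821865893932321861909299384105481033525713837388068226719285945610816982310399674590740708103620157217347757526854042490,
  5185556332822652428511225772049272445914764928262856788923373707541024179612335748391862025986619316735589435032543682551279329172760375356719492584672620892155945184699323726579174951606592776544896515978793663425679936534130091337778344527684552402801891585739877532856350426010616263662241032599973296195476712590865116822570917837583870319764738247119830745863656357216819648930570967357419501857362146757714999809148953160635738462015824064622459719606128359281509038,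
  1281906612960564504568971458300654207282006195058686029566470121470352428595538224415349706553791872527145117442911302174277356047406308340138016522168222537136848104736316813024677043000106327114693038024738568309598819585482655778189645257643475292809023834247918683228840702421734730254660820111084229724687451748708821923558756197157103971979178952733088428964248297189817700548952886159394080538860894832861655721546858727223572158915134866631548475640520074,
  289949289954295802031768332879935473003915504711117890706398637755063195855907797230580244758183662805638426399447400450920968091715011967412701835636608497102097205096566100271173629817621282401482675634330076555458197611916809009783814750725989388298638852914607193729884561847228147255849437871686759274240339034126617935775382870854101229801184263735945122291490544814151819139025756395504183180223749817082847366285306374120966765662545801107873175,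
  69820507641490152517713658214189119302847102673071186064900375562896272453663256494494185927467387950005469954873167926433456139076867584985919085012262861683204485663368230640971334185852298761590007127001792054148273538739418780043370197677894668854181680540078403700702762564291835533947771780746811636200377890335251711886645232161696692299085896632984608694147802203415209049898025781074476020414766174417551115335140731950088642325418226,
  15857500122286265692006345230070139996722042346088160377415271793491456402167570854816616847125099376552681643949432772908490623734956411884392234799225737873973343850475843982585150322129808184390229519052490879992650752061232188664096532643048246006160893523709774456215251839728738502789332124353937183584610065133764792208325190178300061039847799618670111197676653111541278716135151954824467189764282639884364617730684523742310947,
  3660551900591601299928179306436421929965191054331602354023769060207502500537200008896922669348077125850220602550975802203287488004682082960315883437403616789201321686738388725802594524878013336216343984739829524567703437187541176748603955934069515074546114998956050849111715564155307764849995845927825922406978633035421550408086214635304608373205308332347516404161416705518964310568914018510059207999568245311387554463880340,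
  840459104133638542416232794830414479069775800888444152416144177852317725613472249918186721733350538552666912938914912137572784548490531921352127573414566565111535095266963110835308394212392719627090024772412011588997781040656838182080827215235310210658847275787743315504384671713768410569073178489371192929875462616996183801959377322660233811063582371280109670911646449438166927490963590230196111224005610124498937,
  200605670082804818947371396264993834553605206799409384774999672147427209640765691529851811276441504536156890570396896773702761922108689524187468914362522230454530538433536181221083489385126246028852453639055808405755573739876030904034769225523029060720725943944744540595249874914708765331501018268777065641046543549126079545774332123957573243275885040644712722574884603245626029993536044066696887831477020,
  45194300137031612257375914977086134146878910113329607188881397815069689672190756780705919670289925414944878270886855941532820569067591219601866333264484330796122618450418430672839703517821355696070746417965313619309563098292840059302710027817961102088140903417640715903371797330007749907830645083407157558036831882363394735590515197732132081518899537691002375416678122018832126314754179468438087,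
  10418393840692712939168261188808124962532737660359013926193572990774376675388849007031698145792764870525389616253330274297719742179122768668630123845100192412424825204546654778797982970837317252932960535177553296622512316126159956734679130817184722046168281236624992124378999653102658601901250276644185419966564288608833528231015927963557937254601934409689169131288643428289615365026073,
  2457717820441854503352960263383393177538047076825885163330697308790890433253152866466586935302577154543136867227194960998565645101792381499493936560782107512121755603991545717399545037423243593314905479639634905684338444978465797056789923007016731658020028041461147925132631089484791449268131502623624717369405050621358062996470604600259611834923233833823468453939397068283375,
  565725419665393020734933296459424532789285604454162920851400506799079807911722920260407450386761937918472219390724706859810682222564489620714894823959790551615257489800225949763514450187318775013423264570847340364111644668261964311055502920722477639552836773179094644073123393979434424654190573884287744198041025255163995250988734888338249196063659417538983983313426,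
  131416803587182664200219307587426056319613380355077348488045539729399067702019202618750575209613349344342031913644610750036052417097270913704935782575013271085284983321049380883019599182758597433217373541443171752573027235037052178703306789718604818139980539698402417732552883493161014360550067390913476593009572898057363999618026921457379734982634984391800,
  32245022708845618653663399743755501153382170099218690532003886570307974085856449749437111964653397509136646449432686301933355154850067347758960112007069806788793267320184785596227870482183806730871837284178960689698916826302191500366058540408627464954227091947769142885565028829640252648963719347462606967745761214259583225103256176618937673309660,
  7257739444225640573508618878164150785951573973159821267402243234360843538859604602496475953059144634308440098466292897734951305641816349122201110457071570491315360540698680985113123555288310060050816628296359186188534477745460596365837271627262817419748427057990068395345593274809989891708327302416239616819318402734821495685094523845704,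
  1743835615007395124407980915076640529229084149874997110812836944169057394258110805960175759515366539070949551483069065477709298322362355021864194879951337257720863340006342313280406364751311084288478592034469881460527100266866250965985048434931016646109139879592116620337936915912913336566033650460106674962460352909195723262405,
  392389091653344350230908878642704313738615552125403891591464269621678693918618276247801989689698474391716482141975572871580722332118012043011080466359526663340835057042434488297393945850019240361271202047721213933830843624874740618626967734915839178083892468515396094753511203528362480127206802598712584012224304111079,
  92194517202399918734992593398793001431037340226604706234115120476544535527278286908675793234957113435039435004448592437526968857497012293511357897343192048192420662554357239684833954139170917636467778203307724900156224616247926828445792418181086406505156549410106620453874596903637956939413517116255468919940,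
  21087567024003248898583078921086762860209928025221595520179606218504182863845269555019722460201939233857313253960005617827774835886037026036935734947506288983151519366563428260140292799577801550278525298114791990111719101693645253994808268335646822568693190831960863533011041491809782798323569085530,
  5080670990950652193375870746391061772681610918318435632337894833404408548864009263333044054873983401067588148216126474914463915423408564634724487984987226590472779185426177539635890550415151281570011443581753258753561587116812556655803270031130634508453351531510444462618005575956187496585,
  1156984723025715685575137603499477966284012740437748143090761621676119663716793296985516221937804133079742535183962613472959003398806697663339224109268845165846690917682436782259529980500176531555050237650445149859870791891390814735903057207742311032777357046071123589863194043313,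
  264520426821594738819456537902951649098770928058243704775547490123498278762633198246179464817287378400985325026176916422090369894128668718166621533941061158472073175387057801155089393552766222034240374789141033698308107382627856374384308516165107054948914202102038741204,
  62765171222490903995611915015580502362765986598315543991240420770817471124670719309355493227598275197319806103564354155534668159732418470578538068749054818633870801660496987365384958879837644478167570655646036725485386394320114689174139534306299429815528108555,
  14355489519961167736974049406235040259366351239445160756408122884600097106391182071617042471953498888077427883121964027096737823435901994854250935022653199943740493305170960574176265786857383586773136596382110232781812663648060946136453803797095918343,
  3334896966881584484543579867756211856207257389191834888279389400125115613971466675262150174440862583727885078839348528732902922256458286459521830842412235719643745966593088065479836270993838956334296403767732586905885446198767525331445251210,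
  791464231876468253039811460104168756616505301715969397840801287347022321667406862393792737737065525028752867723848669568776638044235378018798281829769535343627153661575376102173677728112648703920085229701311430310423565052225136400,
  181408601055502201355573253343117699013052862423877263628378628999973073840478712269899297410570759210819171124358276042893197447671516685370050812844175022180851017202959328793392503643722382213253129183815316450773463815,
  42116168164763646429577723682503560966815753095729384137379666838389434629103145979077294234149677706180774015724905695655020559259501093513653849024079473438188228324592052845217296705660677947670758681552647224,
  9799086505737492750283173676869155606025677200744411501642820511102449194834727281981793216729771489064638217304645247049987030520622648732680708968994585568703583012077597998380979014644622052114399138,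
  2390530356672029552514079629617484439076033094775909142527546497190090552135013659856522892001440924485597212716254122212614818650108352886347296349790703634423093656092893639533524949894838991,
  540526538735100414297801189482942960565532592177372287154300562455891197659428318464046668336471891182037684452652522054151910346449744451274917332225332762623929572896410059925764798,
  128221951789434553263882842537957284507346297762612733415048566685386536220466825109073820936132276179772660535521635362867234586558468137490905053317763203802210386321816528,
  29110688673908017493496806466605366960447763307245742393540811656676094951496436452460849010064861556736969892796814321810870171970668577725679520041651219076238574,
  6808663451416597335795575937966458554333635334649033960021998300596988400961202978466417475883910925050867524512789516181059167684011607644655546255210110,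
  1570748766266093417408325929024254979829272531412439598903926995245168185307484078150412461316318023201829874680613210415896718605729692888009525,
  373798631739957498001711772607303463732781917099042949670790249955510951256189915543893170624770944488775133286014145481943560369444747,
  85824518807879046311624888799162948115627251844867229283731923080457928143412875502206751305714682671415325284866259427691582,
  19749620704776597782569157907609518398199556753311322077935754124497659035504818586552197116199626868289012409742157,
  4647754109097936985847474608687578374778439170123359916602401475348171539658702674671371969445272670338550,
  1072898822186927587028803473194051374311200204764031229184188481649425359443801255825562247825826,
  248780006641961738428001941668800652518871663929851662222112750340251908515037821333515,
  59150186276110884901763174738389707915477920393731304534885553022443766938230,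
  13526017221240763880164063097276142365785778223340461125325373168762,
  3141385729996388981634377805862222881738320482963820655125,
  730817783002591179249600796673279157886827625213,
  170554667515870984780110021506394785578,
  39647011379305026077138534159,
  9225824684371611602,
  2147603276]

/-- Polynomials in `u`, `v + t`, `v t`, whose squares get the multiplier `(1 + u)(1 - 2 u)`. -/
def tripleSqMul : List Poly₃ := List.map (decode 6) [
  24990683728796243448417150185604124349668811062549253314833844322872920498127325389238657751222115871601818663781928011833800894438864701563938003377019779138822099833100763892060172546079459634100845734617540686226761045588546968184300846516784462043599446281826395060295055993692305365804966769075375939462827491284700418052088359774460341788589413474451909321211775502097114874742251381558361745964244140114361831931135258592217663288900553430164605057536980355564194317719196892,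
  5685001490076390462373946206063602906835443908663858527714779158937365394133139905374227198868238105858555009014093913474590249300862620773821494172172151766544629572113419527941106462658050057490230815679491157159241275626826257072558276736457963385956784118528732238763793381097171400699370609722692319803036848350689945417654394762251973352873536104290814614423018773184897222187100133605685568327250119128123532782655610591625175186126069706996781568948510634180974799,
  1261764531964682494297958112939864798137070927692263521941082208784557795354232223850028037013750264129048445471997178620128422487844855717934418398414688808657616447212595341118758486844379475920665265662032493857127915750836472583658039169511407130841554801070450262865322319703549208740834651379266446444522247224373794106579735102677369162025304062454818211917604517277991910068090929027732352673968337497169297480919382674602832908006346349464792366079804540,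
  322773585374671161354701936530101478160292988260796083264821788555560182367465280973080270373044421744250343172333506110160433004543962881783046480152882535869465146800524161691840835962618573772181360123761985775075202475083777030486030052239246939231799079694612574161068319753276121047443114982617201275961258309853619782781292233168644797155376450422313435585837870039732161507909567923459826007861270552269746789268944571691759953309130847819156642,
  68547160159196988011721858156120880349870505945569758419607557456010631674661072330005865885045208311449205878224182072845100117642123415287097859595258062549787156549999231084770453614421532507205861116921657882963015098579916331948673314673950471818757871356379224592487296772799466271353714110757760800524523906975304035858125378028456957916439713122284932911885543673761898936251138611891128640278151979471808371959665313531571464365280915,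
  16846155455710391678553646726892065460807664747420574326527141517062166883905498027725672594156181463098907426377087145559311702736671622545154220379832514226457526452085596412715209634367266488675198349811007215777598625230970291289449370690015048239754807506782235383166592256563286399553061124034931675517779898581624094281239550470749752800399135042780062928260279722252819718878348332662511361158634462366676933069196528217290980,
  3601406768936635376706937850447264394499700708993724331300008176305673461894115821795867659282951408406929800774109993416626125707962214995177790972289410563821383472718248489755294781073227540515254573984489763020632958944644220326433395913539255087071833898578922187724077815947667135969486982120179238621899370762270890217226568968335468874662282184248784612466481673618036298539708540960819026226285926231837643362809782,
  956643050408239955906162975441290545677987657730960008400969216674294700664675745360972799203056672757836846471889901938347491533887037556296053214370021878566607971103624882825820485966011080980786904019611805273993687504943763221754224796606008931708060997308573226154781436901133743695732839995685763957274478773305299025846161068853881988503281471097164642540658829735026106439002224142565188131710559855599737,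
  206804732059436120482987364416824420420042493659116876571877234064219727855104581343808478649165083820933001631885666795636404838008785899582062841847130934928226000212974386888873143172290298839453128184420989931508624130952352759860348000787550607009910601505504547452407825377339812049158448060020106793048391738466923266035390949312467373857346516812109778248511934440811472302741090860395636431227646,
  48982947030217562715112718572670619420461401067058802636621517270678038859733558684895241744511071495283633056398491055115104838565798657421390356890148271282717335815230940231811989732640600532795335822558939671903607539106358306884130759996707913616740825632665750305550558174182391909727177892343158855806568088804775218596132555116428493641107877593958084778579445894718096240862354633212177,
  10554181570629932192830196587135598658901246064931464273557567840230101387578833561659864463823539877129009579001402775580305608421907804888729802113168032594106276462138821537314251844167342896752819763036847324143767461953174097682302868482222070047849247639189598674025069257858996790195242872466091544176540933108761699286890317031633265202169677363389493872620501874339636351486263,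
  2495704641422122833076056134161549952970896504307220637033585161579056322430514628757575403837033232343586258815725649711030340789606242858259743631055113473539966843206856457810577368743597111053828586716896507757975358172758418063915287006042549305550016752003472036288635551885329598829633559331260168030980127979384521611389552843194257830651728357557833869294742511142116,
  567979436226754085140327123915512209844942178907136071391088825193895650563260887582286060494253110007566746662624960870581325108117063641878375531011499950510847850530669043656498762837075648266310624855904366924399469746653283847069889655849805228155683207010667189214944950460391494741243545342350333754044172483952886843590293936828219060678961142734181370325211,
  144881527300472402088495209675563375751153357128893160901074470879901136281085176203999669929797001442481065455015259380642134487279041863049626428343632117602662421244218652476165592270772165735201327604151426188190300601197820295120539096082179496082702535633581469578912354365877727282058975335753209830238745539730062983963649943921345837068673448216023,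
  32009715840016180148278101015357567251832746021307163654488617417844034049256155025489950180104580341464018617029251831582106217657671781975966581099719756734706265942499427093822549216090156071160157588021556018885672941267144812921671097895297374840737670089057050506329388162553792665037740377500420974559588210367847507639170191857801656558204,
  7521518965899554172627769516133930201797964251235695337208758373037427268289605342616747562749480548420923272730321408364158444668423552880767896260880131828849485859278886742949023177908206823006629935225119053310701533137559635823368221126182723281514759321006137639360018709632698002781146594420929500819149070038936992251900359313198,
  1717814351768285346638281938586424494391234311411502528380096947361608816219252504243713851802449196512218016195978455207900710980938618727512954690856979617032491194882095029005245934162303864447501111693431026831952449193491401802742678063615439777052831392344859702717530253765429676920451495622404814380769969657022449442149,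
  402366860576915526400627159848730042084606692169407293786976277370058675226650846723162151277623501353652458095660467108008197848157475714869091637179297521736596225321318409509680442428535024908335069656204146419717430134120768257502294707256089910783128655290750516684628289226646541591021554772923748377458805563424,
  90244189883080023888485515491592430475879380969412251532886314967723490717580589544071494861299441481739731855379227685853042995669745268122306165539132985334541831855983193853220657881606849718604274574838383138108900432498973597374743950610386293130887261594846908266738509980908401221127684217045935930599,
  21745361696340369424317143792344259134023699319690284671749725099684141381923490298173689526384010884825430156581297981969936979716207176497741253562315528949743150013107352094037892343946470932616077548963008182173607918764923324824953509487570010682513213388175895116275484158780700001661779165771,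
  4907745350853566154856165004265571432244965145779368952549202045083965056743925400734950997844271103253563295864982283297927053886183582633105879260760694693352952884622415301592494961430605609656920421573635567991361703055586443748092315053310541674340628932506773183049170462186542098044,
  1136151949621001185375109212451480915467355260566257657011802442100622210902727542474330623070972213798008060386163429251275859807574427103657355299561047859994455488814512775806214042853720862659906291280910564731375647015332591328574249295977585421203230115774308759957032531208,
  275123958760455316459464330902327435433433433067811543551413707169022282868834505714718975901836431167649597992465950260357189184502649921370585775722360129513262179551195723246427220292366886088384697750671081961622821442616470974315090016199577488329454595418000650025,
  62775599534944545757587752055920970169867246896014494800988340421050328511180545089328682497756266880522280425491741532929759204261388742318122810503995245699399856500599015469792216997698741402370947915512516473395848443293236446505404300434798841409698080113,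
  14862567499290199990962160322369114595373349439192822313707419740358378873340812385825457170503724559678321138938078106773865845240418033645477510712529751958363984966866147012089666726955319708831223274217402690152167967983389385223081210378260079765,
  3394597687026338698390182936668743448064485668881684115381155358679992282372133153634799895534916644820840039449167536502745972403413459574709152306861426074693429583563762031472158796382397905660742741762164226972132402790862125525279800567,
  794234864109098516760624738782921562409804842795496469459263693359656245503960015262920764372437325111694282273970073012431277429128037205939511392388552673924737912337491673083056210620428722714894998828067240067885121596255236347,
  181972839758232701077906840721229318855197477689805998244535757841484361925921782095073522155807154656840738981051725085194750208475803025080986404363480684521455578242306656782184891962678192513006110170132401373459632489,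
  43270742626895050754058432329144821070662704876536582940238940142960834381617612074835494944338726033746243069714341042214748074712028181084457467455133385259304684892109448686576383688411291517508667161668587770,
  9861316553273087507813530626439178306937330645764227395472494617371717230424812295307502172331543611144799824274301157784901601840777814080482136583518037717981697302368180301471608996649236948123076471,
  2283106177461045161134835378808531290337070262198665513660400145120404937535968817820603250633359979983332173745566844435266317649500871096733693397632243166588697709037167321577827721548083124,
  535579269838973143327130106850014116352705735844776915783880474936190606400470795117039496530824332779929951439011528522291020187013525106853918542171614384183766330660127788960326992,
  123884302099723321192654313439655124315044160525467510322623052446778730544438405106619945813453045157031090661904241443542068521149371561533378980810362098728055190312760093,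
  28802997609286376086714275874657966865745385713567103958646553608069443495617882025207330644503561526421516287537187147786662622738169116476553792056972178523945259,
  6863933975216963229371388416901829960532530152556650503783006274848405882922480279804400309097697668965588987731582693198307645623929277257069879049584587,
  1573264382711296755515169033627595123330997556657316516356236596942693800154058365892561364480451818337372897968645328223396709020292632933217909,
  371764656658862657236050693091632810508039930204598413882399188502172034252392956910081260389628193832004794393297504556785111757149030,
  85166484618432293883641853620026103347653547590918085242408067782603130296281376645434726249291320944037125179477157716935580,
  19945607427335878151905653949245327772438567254251085781617534998362722281271801333125719263349225036424357634687831,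
  4602566226814004214372653314816461588687726655185995312735948441879927494660797063492246682665796880313363,
  1089131819647146911411458961266006999929035175145748376826286121410533793790343967185265770778295,
  250268137161920616544188953119771331134307069918877264790649915399423917741653214056726,
  57928257346969127147290519401871617019162433220892238816887658727216653276401,
  13601337809559133502185055481707061033077995658445622020101161985670,
  3142658138167325986526518642343816750767940247579929867624,
  730852100818929443575705968211307429504925884644,
  171618830880439102789737976393950454283,
  39675656516522639498227357286,
  9226576419612565272,
  2147640783]

/-- Univariate polynomials. -/
def pairSq : List Poly₁ :=
  [[346712, -3852589, -130778426, -611552297, -453468816, 2051822541, 3869278064, 1854841955],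
  [132378, -19393323, -169930636, -269232110, 504903344, 1361715418, 741714617], [-489833,
  -15557989, -47718547, 34217679, 191253819, 127154379], [-794989, -8820181, -7198513, 36457854,
  39668679], [-1050900, -3760768, 6284304, 11779173], [-634805, 451323, 3032260], [55391, 1238209],
  [574483]]

/-- Univariate polynomials, whose squares get the multiplier `(1 + u)(1 - 2 u)`. -/
def pairSqMul : List Poly₁ :=
  [[-136811, -23063887, -153827734, -24372394, 1301743410, 2370561674, 1185966931], [-399450,
  1139320, 85791200, 417423966, 670854631, 348377596], [-65588, 11739609, 103499215, 250895671,
  173745547], [589230, 17140024, 63613011, 54531620], [985981, 8674211, 11467208], [972940,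
  3294032], [740100]]

/-- The three-point kernel, a polynomial in `u = ⟪y, z⟫`, `v = ⟪x, y⟫`, `t = ⟪x, z⟫`. -/
def threePoint : Poly₃ :=
  add₃ (kernelTerm legendre₀ factor₀) (add₃ (kernelTerm legendre₁ factor₁)
    (add₃ (kernelTerm legendre₂ factor₂) (add₃ (kernelTerm legendre₃ factor₃)
      (add₃ (kernelTerm legendre₄ factor₄) (kernelTerm legendre₅ factor₅)))))

/-- `(1 + u)(1 - 2 u)`. -/
def interval : Poly₃ := [[[1]], [[-1]], [[-2]]]

/-- A polynomial that is nonnegative for `u` in `[-1, 1/2]`. -/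
def tripleSOS : Poly₃ :=
  subst₃ varU (add₃ varV varT) (mul₃ varV varT)
    (add₃ (fastSumSq tripleSq) (mul₃ interval (fastSumSq tripleSqMul)))

/-- A polynomial in `u` that is nonnegative on `[-1, 1/2]`. -/
def pairSOS : Poly₃ :=
  add₃ (sumSq (pairSq.map (subst₁ varU))) (mul₃ interval (sumSq (pairSqMul.map (subst₁ varU))))

section Certificates

set_option maxRecDepth 100000

theorem isSumSq_tripleSq : IsSumSq tripleSq (fastSumSq tripleSq) := by
  decide +kernel

theorem isSumSq_tripleSqMul : IsSumSq tripleSqMul (fastSumSq tripleSqMul) := by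
  decide +kernel

theorem abs₃_cyclicSum_threePoint_add_tripleSOS_le :
    abs₃ 1 1 1 (add₃ (cyclicSum (add₃ threePoint tripleSOS)) [[[2351613000000000]]]) ≤
      10000000000000 := by
  decide +kernel

theorem abs₃_cyclicSum_threePoint_add_pairSOS_le :
    abs₃ 1 1 1 (add₃ (add₃ (subst₃ one₃ varU varU (cyclicSum threePoint)) pairSOS)
      [[[-8323900000000000]]]) ≤ 500000000000 := by
  decide +kernel

theorem eval₃_threePoint_one : eval₃ (1 : ℤ) 1 1 threePoint = 226887642653090744 := by
  decide +kernel

end Certificates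

/-! ### Positive kernels -/

section PositiveKernel

variable {ι : Type*} [Fintype ι]

/-- Positive kernels, without a symmetry condition. -/
def IsPosKernel (K : ι → ι → ℝ) : Prop := ∀ c : ι → ℝ, 0 ≤ ∑ j, ∑ l, c j * c l * K j l

theorem isPosKernel_mul (h : ι → ℝ) : IsPosKernel fun j l => h j * h l := fun c => by
  have : ∑ j, ∑ l, c j * c l * (h j * h l) = (∑ j, c j * h j) ^ 2 := by
    rw [sq, Finset.sum_mul_sum]
    exact Finset.sum_congr rfl fun j _ => Finset.sum_congr rfl fun l _ => by ring
  rw [this]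
  positivity

theorem isPosKernel_zero : IsPosKernel fun _ _ : ι => 0 := fun c => by simp

theorem IsPosKernel.add {K L : ι → ι → ℝ} (hK : IsPosKernel K) (hL : IsPosKernel L) :
    IsPosKernel fun j l => K j l + L j l := fun c => by
  simp only [mul_add, Finset.sum_add_distrib]
  exact add_nonneg (hK c) (hL c)

theorem IsPosKernel.const_mul {K : ι → ι → ℝ} (hK : IsPosKernel K) {w : ℝ} (hw : 0 ≤ w) :
    IsPosKernel fun j l => w * K j l := fun c => by
  simp only [mul_left_comm _ w, ← Finset.mul_sum]
  exact mul_nonneg hw (hK c)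

theorem IsPosKernel.conj {K : ι → ι → ℝ} (hK : IsPosKernel K) (h : ι → ℝ) :
    IsPosKernel fun j l => K j l * (h j * h l) := fun c => by
  refine (hK fun j => c j * h j).trans_eq
    (Finset.sum_congr rfl fun j _ => Finset.sum_congr rfl fun l _ => ?_)
  ring

theorem isPosKernel_of_eq_sum {n : ℕ} {K : ι → ι → ℝ} (w : Fin n → ℝ) (hw : ∀ m, 0 ≤ w m)
    (h : Fin n → ι → ℝ) (hK : ∀ j l, K j l = ∑ m, w m * (h m j * h m l)) : IsPosKernel K := by
  intro c
  simp only [hK, Finset.mul_sum]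
  rw [Finset.sum_congr rfl fun j _ => Finset.sum_comm, Finset.sum_comm]
  refine Finset.sum_nonneg fun m _ => ?_
  simpa only [Finset.mul_sum] using (isPosKernel_mul (h m)).const_mul (hw m) c

/-! The addition theorem for Legendre polynomials. -/

section Legendre

variable (a b z : ι → ℝ)

/-- The kernel `L(⟪X, Y⟫, |X|² |Y|²)` for points `X, Y` of three-dimensional space. -/
def sphericalKernel (L : Poly₂) (j l : ι) : ℝ :=
  eval₂ (a j * a l + b j * b l + z j * z l)
    ((a j ^ 2 + b j ^ 2 + z j ^ 2) * (a l ^ 2 + b l ^ 2 + z l ^ 2)) L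

theorem isPosKernel_legendre₀ : IsPosKernel (sphericalKernel a b z legendre₀) :=
  isPosKernel_of_eq_sum ![8] (by simp) ![fun _ => 1] fun j l => by
    simp [sphericalKernel, legendre₀, eval₂, eval₁, evalWith]

theorem isPosKernel_legendre₁ : IsPosKernel (sphericalKernel a b z legendre₁) :=
  isPosKernel_of_eq_sum ![8, 8, 8] (by simp [Fin.forall_fin_succ]) ![a, b, z] fun j l => by
    simp [sphericalKernel, legendre₁, eval₂, eval₁, evalWith, Fin.sum_univ_succ]
    ring

theorem isPosKernel_legendre₂ : IsPosKernel (sphericalKernel a b z legendre₂) :=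
  isPosKernel_of_eq_sum ![2, 24, 24, 6, 6] (by simp [Fin.forall_fin_succ])
    ![fun i => 2 * z i ^ 2 - (a i ^ 2 + b i ^ 2), fun i => z i * a i, fun i => z i * b i,
      fun i => a i ^ 2 - b i ^ 2, fun i => 2 * a i * b i] fun j l => by
    simp [sphericalKernel, legendre₂, eval₂, eval₁, evalWith, Fin.sum_univ_succ]
    ring

theorem isPosKernel_legendre₃ : IsPosKernel (sphericalKernel a b z legendre₃) :=
  isPosKernel_of_eq_sum ![2, 3, 3, 30, 30, 5, 5] (by simp [Fin.forall_fin_succ])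
    ![fun i => 2 * z i ^ 3 - 3 * z i * (a i ^ 2 + b i ^ 2),
      fun i => (4 * z i ^ 2 - (a i ^ 2 + b i ^ 2)) * a i,
      fun i => (4 * z i ^ 2 - (a i ^ 2 + b i ^ 2)) * b i,
      fun i => z i * (a i ^ 2 - b i ^ 2), fun i => z i * (2 * a i * b i),
      fun i => a i ^ 3 - 3 * a i * b i ^ 2, fun i => 3 * a i ^ 2 * b i - b i ^ 3] fun j l => by
    simp [sphericalKernel, legendre₃, eval₂, eval₁, evalWith, Fin.sum_univ_succ]
    ring

theorem isPosKernel_legendre₄ : IsPosKernel (sphericalKernel a b z legendre₄) :=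
  isPosKernel_of_eq_sum ![1 / 8, 5, 5, 5 / 2, 5 / 2, 35, 35, 35 / 8, 35 / 8]
    (by simp [Fin.forall_fin_succ]; norm_num)
    ![fun i => 8 * z i ^ 4 - 24 * z i ^ 2 * (a i ^ 2 + b i ^ 2) + 3 * (a i ^ 2 + b i ^ 2) ^ 2,
      fun i => (4 * z i ^ 3 - 3 * z i * (a i ^ 2 + b i ^ 2)) * a i,
      fun i => (4 * z i ^ 3 - 3 * z i * (a i ^ 2 + b i ^ 2)) * b i,
      fun i => (6 * z i ^ 2 - (a i ^ 2 + b i ^ 2)) * (a i ^ 2 - b i ^ 2),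
      fun i => (6 * z i ^ 2 - (a i ^ 2 + b i ^ 2)) * (2 * a i * b i),
      fun i => z i * (a i ^ 3 - 3 * a i * b i ^ 2), fun i => z i * (3 * a i ^ 2 * b i - b i ^ 3),
      fun i => a i ^ 4 - 6 * a i ^ 2 * b i ^ 2 + b i ^ 4,
      fun i => 4 * a i ^ 3 * b i - 4 * a i * b i ^ 3] fun j l => by
    simp [sphericalKernel, legendre₄, eval₂, eval₁, evalWith, Fin.sum_univ_succ]
    ring

theorem isPosKernel_legendre₅ : IsPosKernel (sphericalKernel a b z legendre₅) :=
  isPosKernel_of_eq_sum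
    ![1 / 8, 15 / 8, 15 / 8, 105 / 2, 105 / 2, 35 / 16, 35 / 16, 315 / 8, 315 / 8, 63 / 16, 63 / 16]
    (by simp [Fin.forall_fin_succ]; norm_num)
    ![fun i => z i * (8 * z i ^ 4 - 40 * z i ^ 2 * (a i ^ 2 + b i ^ 2) +
        15 * (a i ^ 2 + b i ^ 2) ^ 2),
      fun i => (8 * z i ^ 4 - 12 * z i ^ 2 * (a i ^ 2 + b i ^ 2) + (a i ^ 2 + b i ^ 2) ^ 2) * a i,
      fun i => (8 * z i ^ 4 - 12 * z i ^ 2 * (a i ^ 2 + b i ^ 2) + (a i ^ 2 + b i ^ 2) ^ 2) * b i,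
      fun i => (2 * z i ^ 3 - z i * (a i ^ 2 + b i ^ 2)) * (a i ^ 2 - b i ^ 2),
      fun i => (2 * z i ^ 3 - z i * (a i ^ 2 + b i ^ 2)) * (2 * a i * b i),
      fun i => (8 * z i ^ 2 - (a i ^ 2 + b i ^ 2)) * (a i ^ 3 - 3 * a i * b i ^ 2),
      fun i => (8 * z i ^ 2 - (a i ^ 2 + b i ^ 2)) * (3 * a i ^ 2 * b i - b i ^ 3),
      fun i => z i * (a i ^ 4 - 6 * a i ^ 2 * b i ^ 2 + b i ^ 4),
      fun i => z i * (4 * a i ^ 3 * b i - 4 * a i * b i ^ 3),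
      fun i => a i ^ 5 - 10 * a i ^ 3 * b i ^ 2 + 5 * a i * b i ^ 4,
      fun i => 5 * a i ^ 4 * b i - 10 * a i ^ 2 * b i ^ 3 + b i ^ 5] fun j l => by
    simp [sphericalKernel, legendre₅, eval₂, eval₁, evalWith, Fin.sum_univ_succ]
    ring

end Legendre

theorem eval₃_zonal (L : Poly₂) (u v t : ℝ) :
    eval₃ u v t (zonal L) = eval₂ (u - v * t) ((1 - v ^ 2) * (1 - t ^ 2)) L := by
  rw [zonal, eval₃_subst₂]
  congr 1 <;> simp [eval₃, eval₂, eval₁, evalWith] <;> ring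

theorem eval₃_tensorSum_cons (p : Poly₁) (ps : List Poly₁) (u v t : ℝ) :
    eval₃ u v t (tensorSum (p :: ps)) = eval₁ v p * eval₁ t p + eval₃ u v t (tensorSum ps) := by
  rw [tensorSum, eval₃_add]
  congr 1
  simp only [eval₃, evalWith, eval₂, mul_zero, add_zero, evalWith_map, eval₁, Int.cast_mul,
    evalWith_const_mul]
  simp only [mul_comm _ (evalWith Int.cast t p), evalWith_const_mul]

theorem isPosKernel_kernelTerm {L : Poly₂} {u : ι → ι → ℝ} {v : ι → ℝ}
    (h : IsPosKernel fun j l => eval₂ (u j l - v j * v l) ((1 - v j ^ 2) * (1 - v l ^ 2)) L)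
    (ps : List Poly₁) : IsPosKernel fun j l => eval₃ (u j l) (v j) (v l) (kernelTerm L ps) := by
  simp only [kernelTerm, eval₃_mul, eval₃_zonal]
  induction ps with
  | nil => simpa [tensorSum, eval₃, evalWith] using isPosKernel_zero
  | cons p ps ih =>
    simp only [eval₃_tensorSum_cons, mul_add]
    exact (h.conj fun j => eval₁ (v j) p).add ih

theorem isPosKernel_threePoint {u : ι → ι → ℝ} {v a b z : ι → ℝ}
    (hu : ∀ j l, u j l - v j * v l = a j * a l + b j * b l + z j * z l)
    (hv : ∀ j, 1 - v j ^ 2 = a j ^ 2 + b j ^ 2 + z j ^ 2) :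
    IsPosKernel fun j l => eval₃ (u j l) (v j) (v l) threePoint := by
  have key {L : Poly₂} (h : IsPosKernel (sphericalKernel a b z L)) (ps : List Poly₁) :
      IsPosKernel fun j l => eval₃ (u j l) (v j) (v l) (kernelTerm L ps) :=
    isPosKernel_kernelTerm (by simp only [hu, hv]; exact h) ps
  simp only [threePoint, eval₃_add]
  exact (key (isPosKernel_legendre₀ a b z) _).add <| (key (isPosKernel_legendre₁ a b z) _).add <|
    (key (isPosKernel_legendre₂ a b z) _).add <| (key (isPosKernel_legendre₃ a b z) _).add <|
    (key (isPosKernel_legendre₄ a b z) _).add (key (isPosKernel_legendre₅ a b z) _)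

end PositiveKernel

theorem threePoint_sum_nonneg {ι : Type*} [Fintype ι] {x : ι → EuclideanSpace ℝ (Fin 4)}
    (hx : ∀ i, ‖x i‖ = 1) (e : EuclideanSpace ℝ (Fin 4)) (he : ‖e‖ = 1) :
    0 ≤ ∑ j, ∑ l, eval₃ ⟪x j, x l⟫ ⟪e, x j⟫ ⟪e, x l⟫ threePoint := by
  have hinner (y z : EuclideanSpace ℝ (Fin 4)) :
      ⟪y, z⟫ = y 0 * z 0 + y 1 * z 1 + y 2 * z 2 + y 3 * z 3 := by
    simp [PiLp.inner_apply, Fin.sum_univ_four, mul_comm]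
  have hone {y : EuclideanSpace ℝ (Fin 4)} (hy : ‖y‖ = 1) :
      y 0 * y 0 + y 1 * y 1 + y 2 * y 2 + y 3 * y 3 = 1 := by
    rw [← hinner, real_inner_self_eq_norm_sq, hy, one_pow]
  have h := isPosKernel_threePoint (u := fun j l => ⟪x j, x l⟫) (v := fun j => ⟪e, x j⟫)
    (a := fun j => -e 1 * x j 0 + e 0 * x j 1 - e 3 * x j 2 + e 2 * x j 3)
    (b := fun j => -e 2 * x j 0 + e 3 * x j 1 + e 0 * x j 2 - e 1 * x j 3)
    (z := fun j => -e 3 * x j 0 - e 2 * x j 1 + e 1 * x j 2 + e 0 * x j 3)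
    (fun j l => by
      simp only [hinner]
      linear_combination -(x j 0 * x l 0 + x j 1 * x l 1 + x j 2 * x l 2 + x j 3 * x l 3) * hone he)
    (fun j => by
      simp only [hinner]
      linear_combination -hone (hx j) -
        (x j 0 * x j 0 + x j 1 * x j 1 + x j 2 * x j 2 + x j 3 * x j 3) * hone he)
  simpa using h 1

/-! ### Bounds for the kernel -/

theorem eval₃_interval_nonneg {u : ℝ} (h₁ : -1 ≤ u) (h₂ : u ≤ 1 / 2) (v t : ℝ) :
    0 ≤ eval₃ u v t interval := by
  simp [interval, eval₃, eval₂, eval₁, evalWith]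
  nlinarith

theorem eval₃_tripleSOS_nonneg {u : ℝ} (h₁ : -1 ≤ u) (h₂ : u ≤ 1 / 2) (v t : ℝ) :
    0 ≤ eval₃ u v t tripleSOS := by
  have hu : eval₃ u v t varU = u := by simp [varU, eval₃, eval₂, eval₁, evalWith]
  rw [tripleSOS, eval₃_subst₃, hu, eval₃_add _ _ _ (fastSumSq _), eval₃_mul _ _ _ interval]
  exact add_nonneg (eval₃_nonneg_of_isSumSq isSumSq_tripleSq _ _ _)
    (mul_nonneg (eval₃_interval_nonneg h₁ h₂ _ _)
      (eval₃_nonneg_of_isSumSq isSumSq_tripleSqMul _ _ _))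

theorem eval₃_pairSOS_nonneg {u : ℝ} (h₁ : -1 ≤ u) (h₂ : u ≤ 1 / 2) (v t : ℝ) :
    0 ≤ eval₃ u v t pairSOS := by
  rw [pairSOS, eval₃_add, eval₃_mul]
  exact add_nonneg (eval₃_sumSq_nonneg _ _ _ _)
    (mul_nonneg (eval₃_interval_nonneg h₁ h₂ _ _) (eval₃_sumSq_nonneg _ _ _ _))

theorem cyclicSum_threePoint_le {u v t : ℝ} (hu₁ : -1 ≤ u) (hu₂ : u ≤ 1 / 2) (hv₁ : -1 ≤ v)
    (hv₂ : v ≤ 1 / 2) (ht₁ : -1 ≤ t) (ht₂ : t ≤ 1 / 2) :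
    eval₃ u v t (cyclicSum threePoint) ≤ -2341613000000000 := by
  have hbound := abs_eval₃_le (x := u) (y := v) (z := t) (X := 1) (Y := 1) (Z := 1)
    (abs_le.2 (by constructor <;> push_cast <;> linarith))
    (abs_le.2 (by constructor <;> push_cast <;> linarith))
    (abs_le.2 (by constructor <;> push_cast <;> linarith))
    (add₃ (cyclicSum (add₃ threePoint tripleSOS)) [[[2351613000000000]]])
  have hcert : ((abs₃ 1 1 1 (add₃ (cyclicSum (add₃ threePoint tripleSOS))
    [[[2351613000000000]]]) : ℕ) : ℝ) ≤ (10000000000000 : ℕ) :=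
    Nat.cast_le.2 abs₃_cyclicSum_threePoint_add_tripleSOS_le
  have h := (le_abs_self _).trans (hbound.trans hcert)
  rw [eval₃_add, eval₃_const] at h
  simp only [eval₃_cyclicSum, eval₃_add] at h ⊢
  push_cast at h
  linarith [eval₃_tripleSOS_nonneg hu₁ hu₂ v t, eval₃_tripleSOS_nonneg ht₁ ht₂ u v,
    eval₃_tripleSOS_nonneg hv₁ hv₂ t u]

theorem cyclicSum_threePoint_pair_le {w : ℝ} (h₁ : -1 ≤ w) (h₂ : w ≤ 1 / 2) :
    eval₃ 1 w w (cyclicSum threePoint) ≤ 8324400000000000 := by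
  have hbound := abs_eval₃_le (x := w) (y := 0) (z := 0) (X := 1) (Y := 1) (Z := 1)
    (abs_le.2 (by constructor <;> push_cast <;> linarith)) (by simp) (by simp)
    (add₃ (add₃ (subst₃ one₃ varU varU (cyclicSum threePoint)) pairSOS) [[[-8323900000000000]]])
  have hcert : ((abs₃ 1 1 1 (add₃ (add₃ (subst₃ one₃ varU varU (cyclicSum threePoint)) pairSOS)
    [[[-8323900000000000]]]) : ℕ) : ℝ) ≤ (500000000000 : ℕ) :=
    Nat.cast_le.2 abs₃_cyclicSum_threePoint_add_pairSOS_le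
  have h := (le_abs_self _).trans (hbound.trans hcert)
  have hu : eval₃ w 0 0 varU = w := by simp [varU, eval₃, eval₂, eval₁, evalWith]
  have hone : eval₃ w 0 0 one₃ = 1 := by simp [one₃, eval₃, eval₂, eval₁, evalWith]
  rw [eval₃_add, eval₃_add, eval₃_const, eval₃_subst₃, hu, hone] at h
  push_cast at h
  linarith [eval₃_pairSOS_nonneg h₁ h₂ 0 0]

theorem cyclicSum_threePoint_one :
    eval₃ (1 : ℝ) 1 1 (cyclicSum threePoint) = 680662927959272232 := by
  have h : eval₃ (1 : ℝ) 1 1 threePoint = 226887642653090744 := by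
    have := cast_eval₃ (R := ℝ) 1 1 1 threePoint
    rw [eval₃_threePoint_one] at this
    push_cast at this
    exact this.symm
  rw [eval₃_cyclicSum, h]
  norm_num

theorem eval₃_cyclicSum_rotate (x y z : ℝ) (p : Poly₃) :
    eval₃ x y z (cyclicSum p) = eval₃ z x y (cyclicSum p) := by
  simp only [eval₃_cyclicSum]
  ring

theorem sum_cyclicSum_threePoint_nonneg {ι : Type*} [Fintype ι]
    {x : ι → EuclideanSpace ℝ (Fin 4)} (hx : ∀ i, ‖x i‖ = 1) :
    0 ≤ ∑ i, ∑ j, ∑ l, eval₃ ⟪x j, x l⟫ ⟪x i, x j⟫ ⟪x i, x l⟫ (cyclicSum threePoint) := by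
  set f : ι → ι → ι → ℝ := fun i j l => eval₃ ⟪x j, x l⟫ ⟪x i, x j⟫ ⟪x i, x l⟫ threePoint with hf
  have hnonneg : 0 ≤ ∑ i, ∑ j, ∑ l, f i j l :=
    Finset.sum_nonneg fun i _ => threePoint_sum_nonneg hx (x i) (hx i)
  have hterm (i j l : ι) : eval₃ ⟪x j, x l⟫ ⟪x i, x j⟫ ⟪x i, x l⟫ (cyclicSum threePoint) =
      f i j l + (f j l i + f l i j) := by
    simp only [hf, eval₃_cyclicSum, real_inner_comm]
  have h₁ : ∑ i, ∑ j, ∑ l, f j l i = ∑ i, ∑ j, ∑ l, f i j l := by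
    rw [Finset.sum_comm]
    exact Finset.sum_congr rfl fun j _ => Finset.sum_comm
  have h₂ : ∑ i, ∑ j, ∑ l, f l i j = ∑ i, ∑ j, ∑ l, f i j l := by
    rw [Finset.sum_congr rfl fun i _ => Finset.sum_comm, Finset.sum_comm]
  simp only [hterm, Finset.sum_add_distrib, h₁, h₂]
  linarith

/-- A bound for the cyclic sum of the kernel that depends on coincidences among three points. -/
theorem cyclicSum_threePoint_inner_le {ι : Type*} [DecidableEq ι]
    {x : ι → EuclideanSpace ℝ (Fin 4)} (hx : ∀ i, ‖x i‖ = 1)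
    (hsep : ∀ i j, i ≠ j → ⟪x i, x j⟫ ≤ 1 / 2) (i j l : ι) :
    eval₃ ⟪x j, x l⟫ ⟪x i, x j⟫ ⟪x i, x l⟫ (cyclicSum threePoint) ≤
      -2341613000000000 + ((if i = j then 10666013000000000 else 0) +
        (if j = l then 10666013000000000 else 0) + (if i = l then 10666013000000000 else 0)) +
        if i = j then if j = l then 651006501959272232 else 0 else 0 := by
  have hself (i : ι) : ⟪x i, x i⟫ = 1 := by rw [real_inner_self_eq_norm_sq, hx, one_pow]
  have hlower (i j : ι) : -1 ≤ ⟪x i, x j⟫ := by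
    have := neg_le_of_abs_le (abs_real_inner_le_norm (x i) (x j))
    rwa [hx, hx, mul_one] at this
  rcases eq_or_ne i j with rfl | hij
  · rcases eq_or_ne i l with rfl | hil
    · simp only [hself, cyclicSum_threePoint_one, if_true]
      norm_num
    · rw [hself, eval₃_cyclicSum_rotate, eval₃_cyclicSum_rotate]
      simp only [hil, if_true, if_false]
      linarith [cyclicSum_threePoint_pair_le (hlower i l) (hsep i l hil)]
  · rcases eq_or_ne j l with rfl | hjl
    · rw [hself]
      simp only [hij, if_true, if_false]
      linarith [cyclicSum_threePoint_pair_le (hlower i j) (hsep i j hij)]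
    · rcases eq_or_ne i l with rfl | hil
      · rw [hself, eval₃_cyclicSum_rotate, real_inner_comm]
        simp only [hij, hjl, if_true, if_false]
        linarith [cyclicSum_threePoint_pair_le (hlower i j) (hsep i j hij)]
      · simp only [hij, hjl, hil, if_false]
        linarith [cyclicSum_threePoint_le (hlower j l) (hsep j l hjl) (hlower i j) (hsep i j hij)
          (hlower i l) (hsep i l hil)]

theorem not_exists_kissing_twentyFive {x : Fin 25 → EuclideanSpace ℝ (Fin 4)}
    (hx : ∀ i, ‖x i‖ = 1) (hsep : ∀ i j, i ≠ j → ⟪x i, x j⟫ ≤ 1 / 2) : False := by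
  have h := (sum_cyclicSum_threePoint_nonneg hx).trans
    (Finset.sum_le_sum fun i _ => Finset.sum_le_sum fun j _ => Finset.sum_le_sum fun l _ =>
      cyclicSum_threePoint_inner_le hx hsep i j l)
  have hinner (i j : Fin 25) :
      ∑ l, (if i = j then if j = l then (651006501959272232 : ℝ) else 0 else 0) =
        if i = j then 651006501959272232 else 0 := by
    split_ifs <;> simp
  simp only [Finset.sum_add_distrib, hinner, Finset.sum_ite_eq, Finset.mem_univ, if_true,
    Finset.sum_const, Finset.card_univ, Fintype.card_fin, nsmul_eq_mul] at h
  norm_num at h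

end KissingDimFour

/-- The kissing number in dimension 4 is at most 24. -/
theorem kissing_dim4_le (N : ℕ)
    (x : Fin N → EuclideanSpace ℝ (Fin 4))
    (hx : ∀ i, ‖x i‖ = 1)
    (hsep : ∀ i j, i ≠ j → ⟪x i, x j⟫ ≤ 1 / 2) :
    N ≤ 24 := by
  by_contra! hN
  exact KissingDimFour.not_exists_kissing_twentyFive (x := fun i => x (Fin.castLE hN i))
    (fun i => hx _) fun i j hij => hsep _ _ ((Fin.castLE_injective hN).ne hij)
end
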